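/- arXiv:2405.13302 — 5 statements merged into one kernel-verified Lean document; each statement's English description precedes it below -/
import Mathlib

section
/- Let (X, d) be a metric space in which the distance between any two distinct points is a positive integer, and let x, y ∈ X satisfy d(x, y) = 1. Let μ_x and μ_y be finitely supported probability measures on X with μ_x supported on {z : d(z, x) = 1} and μ_y supported on {z : d(z, y) = 1}. Then W₁(μ_x, μ_y) ≤ 1 + (1 − μ_x(y) − μ_y(x) − Σ_{z : d(z,x)=1, d(z,y)=1} max(μ_x(z), μ_y(z)))₊ + (1 − μ_x(y) − μ_y(x) − Σ_{z : d(z,x)=1, d(z,y)=1} min(μ_x(z), μ_y(z)))₊ − Σ_{z : d(z,x)=1, d(z,y)=1} min(μ_x(z), μ_y(z)). -/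
open scoped Classical

/-- Wasserstein distance between finitely supported mass functions `μ ν : X → ℝ`,
defined as the infimum of total transport cost over all finitely supported couplings. -/
noncomputable def W1 {X : Type*} (d : X → X → ℝ) (μ ν : X → ℝ) : ℝ :=
  sInf { c : ℝ | ∃ γ : (X × X) →₀ ℝ,
    (∀ p, 0 ≤ γ p) ∧
    (∀ u : X, (∑ᶠ v : X, γ (u, v)) = μ u) ∧
    (∀ v : X, (∑ᶠ u : X, γ (u, v)) = ν v) ∧
    c = ∑ᶠ p : X × X, d p.1 p.2 * γ p }

/-- `μ : X → ℝ` is a finitely supported probability mass function. -/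
def IsFinProb {X : Type*} (μ : X → ℝ) : Prop :=
  (∀ z, 0 ≤ μ z) ∧ (Function.support μ).Finite ∧ (∑ᶠ z, μ z) = 1

/-- The total cost of a coupling concentrated on `s × s` bounds the Wasserstein distance. -/
theorem W1_le_sum_of_coupling {X : Type*} {d : X → X → ℝ} (hd : ∀ u v, 0 ≤ d u v)
    {μ ν : X → ℝ} (s : Finset X) (γ : X → X → ℝ) (hγ : ∀ u v, 0 ≤ γ u v)
    (hs : ∀ u v, γ u v ≠ 0 → u ∈ s ∧ v ∈ s)
    (hμ : ∀ u, ∑ v ∈ s, γ u v = μ u) (hν : ∀ v, ∑ u ∈ s, γ u v = ν v) :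
    W1 d μ ν ≤ ∑ u ∈ s, ∑ v ∈ s, d u v * γ u v := by
  refine csInf_le ⟨0, ?_⟩ ⟨Finsupp.onFinset (s ×ˢ s) (fun p => γ p.1 p.2) ?_, ?_, ?_, ?_, ?_⟩
  · rintro c ⟨γ', h0, -, -, rfl⟩
    exact finsum_nonneg fun p => mul_nonneg (hd _ _) (h0 p)
  · exact fun p hp => Finset.mem_product.2 (hs _ _ hp)
  · exact fun p => hγ _ _
  · intro u
    simp only [Finsupp.onFinset_apply]
    rw [finsum_eq_sum_of_support_subset (s := s) _ fun v hv => (hs u v hv).2, hμ]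
  · intro v
    simp only [Finsupp.onFinset_apply]
    rw [finsum_eq_sum_of_support_subset (s := s) _ fun u hu => (hs u v hu).1, hν]
  · simp only [Finsupp.onFinset_apply]
    rw [finsum_eq_sum_of_support_subset (s := s ×ˢ s), Finset.sum_product]
    exact fun p hp => Finset.mem_coe.2 (Finset.mem_product.2 (hs _ _ (right_ne_zero_of_mul hp)))

/-- If `μ` and `ν` share a part `δ` and their remainders split into classes `α i` and `β j`, then a
transport plan `g` between the classes bounds the Wasserstein distance. -/
theorem W1_le_sum_of_class_plan {X ι κ : Type*} [Fintype ι] [Fintype κ]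
    {d : X → X → ℝ} (hd : ∀ u v, 0 ≤ d u v) (hd0 : ∀ u, d u u = 0) {μ ν : X → ℝ} (s : Finset X)
    (α : ι → X → ℝ) (β : κ → X → ℝ) (δ : X → ℝ) (g c : ι → κ → ℝ)
    (hα : ∀ i u, 0 ≤ α i u) (hβ : ∀ j v, 0 ≤ β j v) (hδ : ∀ u, 0 ≤ δ u)
    (hαs : ∀ i u, α i u ≠ 0 → u ∈ s) (hβs : ∀ j v, β j v ≠ 0 → v ∈ s)
    (hδs : ∀ u, δ u ≠ 0 → u ∈ s)
    (hμ : ∀ u, ∑ i, α i u + δ u = μ u) (hν : ∀ v, ∑ j, β j v + δ v = ν v)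
    (hg : ∀ i j, 0 ≤ g i j)
    (hgα : ∀ i, ∑ j, g i j = ∑ u ∈ s, α i u) (hgβ : ∀ j, ∑ i, g i j = ∑ v ∈ s, β j v)
    (hc : ∀ i j u v, α i u ≠ 0 → β j v ≠ 0 → d u v ≤ c i j) :
    W1 d μ ν ≤ ∑ i, ∑ j, g i j * c i j := by
  set p : ι → ℝ := fun i => ∑ u ∈ s, α i u with hp
  set q : κ → ℝ := fun j => ∑ v ∈ s, β j v with hq
  have hp0 : ∀ i, 0 ≤ p i := fun i => Finset.sum_nonneg fun u _ => hα i u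
  have hq0 : ∀ j, 0 ≤ q j := fun j => Finset.sum_nonneg fun v _ => hβ j v
  have hαp : ∀ i u, p i * (α i u / p i) = α i u := by
    intro i u
    refine mul_div_cancel_of_imp' fun h => ?_
    by_contra hne
    exact hne ((Finset.sum_eq_zero_iff_of_nonneg fun u _ => hα i u).1 h u (hαs i u hne))
  have hβq : ∀ j v, q j * (β j v / q j) = β j v := by
    intro j v
    refine mul_div_cancel_of_imp' fun h => ?_
    by_contra hne
    exact hne ((Finset.sum_eq_zero_iff_of_nonneg fun v _ => hβ j v).1 h v (hβs j v hne))
  have hgp : ∀ i j, g i j * ∑ u ∈ s, α i u / p i = g i j := by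
    intro i j
    rw [← Finset.sum_div]
    by_cases h : p i = 0
    · have := (Finset.sum_eq_zero_iff_of_nonneg fun j _ => hg i j).1 ((hgα i).trans h) j
        (Finset.mem_univ j)
      simp [this]
    · rw [div_self h, mul_one]
  have hgq : ∀ i j, g i j * ∑ v ∈ s, β j v / q j = g i j := by
    intro i j
    rw [← Finset.sum_div]
    by_cases h : q j = 0
    · have := (Finset.sum_eq_zero_iff_of_nonneg fun i _ => hg i j).1 ((hgβ j).trans h) i
        (Finset.mem_univ i)
      simp [this]
    · rw [div_self h, mul_one]
  refine (W1_le_sum_of_coupling hd s (fun u v => ∑ i, ∑ j, g i j * (α i u / p i) * (β j v / q j) +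
    if u = v then δ u else 0) ?_ ?_ ?_ ?_).trans ?_
  · intro u v
    refine add_nonneg (Finset.sum_nonneg fun i _ => Finset.sum_nonneg fun j _ => ?_) ?_
    · exact mul_nonneg (mul_nonneg (hg i j) (div_nonneg (hα i u) (hp0 i)))
        (div_nonneg (hβ j v) (hq0 j))
    · split_ifs
      exacts [hδ u, le_rfl]
  · intro u v h
    by_contra hne
    refine h ?_
    have h1 : ∀ i j, g i j * (α i u / p i) * (β j v / q j) = 0 := by
      intro i j
      by_cases hu : α i u = 0
      · simp [hu]
      by_cases hv : β j v = 0
      · simp [hv]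
      exact absurd ⟨hαs i u hu, hβs j v hv⟩ hne
    have h2 : (if u = v then δ u else 0) = 0 := by
      split_ifs with huv
      · subst huv
        by_contra h0
        exact hne ⟨hδs u h0, hδs u h0⟩
      · rfl
    simp only [h1, h2, Finset.sum_const_zero, add_zero]
  · intro u
    rw [Finset.sum_add_distrib, Finset.sum_comm, ← hμ u]
    congr 1
    · refine Finset.sum_congr rfl fun i _ => ?_
      rw [Finset.sum_comm]
      calc _ = ∑ j, (g i j * ∑ v ∈ s, β j v / q j) * (α i u / p i) :=
            Finset.sum_congr rfl fun j _ => by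
              rw [Finset.mul_sum, Finset.sum_mul]
              exact Finset.sum_congr rfl fun v _ => by ring
        _ = α i u := by
              simp only [hgq]
              rw [← Finset.sum_mul, hgα, hαp]
    · rw [Finset.sum_ite_eq]
      split_ifs with h
      · rfl
      · by_contra h0
        exact h (hδs u (Ne.symm h0))
  · intro v
    rw [Finset.sum_add_distrib, Finset.sum_comm, ← hν v]
    congr 1
    · rw [Finset.sum_congr rfl fun i _ => Finset.sum_comm, Finset.sum_comm]
      refine Finset.sum_congr rfl fun j _ => ?_
      calc _ = ∑ i, (g i j * ∑ u ∈ s, α i u / p i) * (β j v / q j) :=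
            Finset.sum_congr rfl fun i _ => by
              rw [Finset.mul_sum, Finset.sum_mul]
        _ = β j v := by
              simp only [hgp]
              rw [← Finset.sum_mul, hgβ, hβq]
    · rw [Finset.sum_ite_eq']
      split_ifs with h
      · rfl
      · by_contra h0
        exact h (hδs v (Ne.symm h0))
  · calc _ ≤ ∑ u ∈ s, ∑ v ∈ s, ∑ i, ∑ j, g i j * c i j * ((α i u / p i) * (β j v / q j)) := by
          refine Finset.sum_le_sum fun u _ => Finset.sum_le_sum fun v _ => ?_
          have h0 : d u v * (if u = v then δ u else 0) = 0 := by
            split_ifs with huv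
            · rw [huv, hd0, zero_mul]
            · exact mul_zero _
          rw [mul_add, h0, add_zero, Finset.mul_sum]
          refine Finset.sum_le_sum fun i _ => ?_
          rw [Finset.mul_sum]
          refine Finset.sum_le_sum fun j _ => ?_
          by_cases hu : α i u = 0
          · simp [hu]
          by_cases hv : β j v = 0
          · simp [hv]
          have hw : 0 ≤ g i j * ((α i u / p i) * (β j v / q j)) := mul_nonneg (hg i j)
            (mul_nonneg (div_nonneg (hα i u) (hp0 i)) (div_nonneg (hβ j v) (hq0 j)))
          calc _ = d u v * (g i j * ((α i u / p i) * (β j v / q j))) := by ring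
            _ ≤ c i j * (g i j * ((α i u / p i) * (β j v / q j))) :=
              mul_le_mul_of_nonneg_right (hc i j u v hu hv) hw
            _ = _ := by ring
      _ = ∑ i, ∑ j, c i j * ((g i j * ∑ u ∈ s, α i u / p i) * ∑ v ∈ s, β j v / q j) := by
          rw [Finset.sum_congr rfl fun u _ => Finset.sum_comm, Finset.sum_comm]
          refine Finset.sum_congr rfl fun i _ => ?_
          rw [Finset.sum_congr rfl fun u _ => Finset.sum_comm, Finset.sum_comm]
          refine Finset.sum_congr rfl fun j _ => ?_
          rw [mul_assoc, Finset.sum_mul_sum, Finset.mul_sum, Finset.mul_sum]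
          refine Finset.sum_congr rfl fun u _ => ?_
          rw [Finset.mul_sum, Finset.mul_sum]
          exact Finset.sum_congr rfl fun v _ => by ring
      _ ≤ _ := by
          simp only [hgp, hgq, mul_comm, le_refl]

/-- The north-west corner plan between three classes of masses `p` and `q`, evaluated for the costs
that arise when the classes are the other endpoint, the common neighbours and the remaining
neighbours. -/
theorem exists_three_class_plan {p q : Fin 3 → ℝ} (hp : ∀ i, 0 ≤ p i) (hq : ∀ j, 0 ≤ q j)
    (hpq : ∑ i, p i = ∑ j, q j) :
    ∃ g : Fin 3 → Fin 3 → ℝ, (∀ i j, 0 ≤ g i j) ∧ (∀ i, ∑ j, g i j = p i) ∧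
      (∀ j, ∑ i, g i j = q j) ∧
      ∑ i, ∑ j, g i j * ![![1, 1, 1], ![2, 2, 1], ![3, 2, 1]] i j =
        ∑ i, p i + max (q 0 + q 1 - p 0) 0 + max (q 0 - p 0 - p 1) 0 := by
  have hp0 := hp 0
  have hp1 := hp 1
  have hp2 := hp 2
  have hq0 := hq 0
  have hq1 := hq 1
  have hq2 := hq 2
  simp only [Fin.sum_univ_three] at hpq ⊢
  let S : Fin 4 → ℝ := ![0, p 0, p 0 + p 1, p 0 + p 1 + p 2]
  let T : Fin 4 → ℝ := ![0, q 0, q 0 + q 1, q 0 + q 1 + q 2]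
  have hS : ∀ i : Fin 3, S i.succ = S i.castSucc + p i := by
    intro i; fin_cases i <;> simp [S]
  have hT : ∀ j : Fin 3, T j.succ = T j.castSucc + q j := by
    intro i; fin_cases i <;> simp [T]
  have hS0 : ∀ k, min (S k) (T 0) = 0 := by
    intro k; fin_cases k <;> simp [S, T] <;> linarith
  have hT0 : ∀ k, min (S 0) (T k) = 0 := by
    intro k; fin_cases k <;> simp [S, T] <;> linarith
  have hS3 : ∀ k, min (S k) (T 3) = S k := by
    intro k; fin_cases k <;> simp [S, T] <;> linarith
  have hT3 : ∀ k, min (S 3) (T k) = T k := by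
    intro k; fin_cases k <;> simp [S, T] <;> linarith
  refine ⟨fun i j => min (S i.succ) (T j.succ) - min (S i.castSucc) (T j.succ) -
    min (S i.succ) (T j.castSucc) + min (S i.castSucc) (T j.castSucc), ?_, ?_, ?_, ?_⟩
  · intro i j
    have h1 := hS i
    have h2 := hT j
    have h3 := hp i
    have h4 := hq j
    simp only [min_def]
    split_ifs <;> linarith
  · intro i
    have h1 := hS3 i.succ
    have h2 := hS3 i.castSucc
    have h3 := hS0 i.succ
    have h4 := hS0 i.castSucc
    have h5 := hS i
    simp only [Fin.reduceSucc, Fin.reduceCastSucc]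
    linarith
  · intro j
    have h1 := hT3 j.succ
    have h2 := hT3 j.castSucc
    have h3 := hT0 j.succ
    have h4 := hT0 j.castSucc
    have h5 := hT j
    simp only [Fin.reduceSucc, Fin.reduceCastSucc]
    linarith
  · have h1 : max (q 0 + q 1 - p 0) 0 = T 2 - min (S 1) (T 2) := by
      change _ = q 0 + q 1 - min (p 0) (q 0 + q 1)
      grind
    have h2 : max (q 0 - p 0 - p 1) 0 = T 1 - min (S 2) (T 1) := by
      change _ = q 0 - min (p 0 + p 1) (q 0)
      grind
    have h3 : S 3 = p 0 + p 1 + p 2 := rfl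
    rw [h1, h2, ← h3]
    simp only [Fin.reduceSucc, Fin.reduceCastSucc, hS0, hT0, hS3, hT3, Matrix.cons_val]
    ring

/-- Upper bound on the Wasserstein distance between local measures at adjacent points
of a metric space with integer-valued distances (Theorem: general lower bound of ORC). -/
theorem wasserstein_upper_bound {X : Type*} [MetricSpace X]
    (hint : ∀ u v : X, u ≠ v → ∃ n : ℕ, 0 < n ∧ dist u v = n)
    (x y : X) (hxy : dist x y = 1)
    (μx μy : X → ℝ) (hμx : IsFinProb μx) (hμy : IsFinProb μy)
    (hsx : ∀ z, μx z ≠ 0 → dist z x = 1)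
    (hsy : ∀ z, μy z ≠ 0 → dist z y = 1) :
    W1 (fun u v => dist u v) μx μy ≤
      1 + max (1 - μx y - μy x -
            ∑ᶠ z, if dist z x = 1 ∧ dist z y = 1 then max (μx z) (μy z) else 0) 0
        + max (1 - μx y - μy x -
            ∑ᶠ z, if dist z x = 1 ∧ dist z y = 1 then min (μx z) (μy z) else 0) 0
        - ∑ᶠ z, if dist z x = 1 ∧ dist z y = 1 then min (μx z) (μy z) else 0 := by
  obtain ⟨hx0, hxf, hx1⟩ := hμx
  obtain ⟨hy0, hyf, hy1⟩ := hμy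
  set s : Finset X := hxf.toFinset ∪ hyf.toFinset with hs
  have hxs : ∀ z, μx z ≠ 0 → z ∈ s := fun z hz => by simp [hs, hz]
  have hys : ∀ z, μy z ≠ 0 → z ∈ s := fun z hz => by simp [hs, hz]
  have hmins : ∀ z, min (μx z) (μy z) ≠ 0 → z ∈ s := by
    intro z hz
    by_contra h
    have h1 : μx z = 0 := not_not.1 (mt (hxs z) h)
    have h2 : μy z = 0 := not_not.1 (mt (hys z) h)
    exact hz (by rw [h1, h2, min_self])
  have hmaxs : ∀ z, max (μx z) (μy z) ≠ 0 → z ∈ s := by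
    intro z hz
    by_contra h
    have h1 : μx z = 0 := not_not.1 (mt (hxs z) h)
    have h2 : μy z = 0 := not_not.1 (mt (hys z) h)
    exact hz (by rw [h1, h2, max_self])
  have hxx : μx x = 0 := by
    by_contra h
    simpa using hsx x h
  have hyy : μy y = 0 := by
    by_contra h
    simpa using hsy y h
  have hyx : dist y x = 1 := by rw [dist_comm, hxy]
  let C : X → Prop := fun z => dist z x = 1 ∧ dist z y = 1
  have hCx : ∀ z, C z → z ≠ x := by
    rintro z h rfl
    simpa using h.1
  have hCy : ∀ z, C z → z ≠ y := by
    rintro z h rfl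
    simpa using h.2
  let δ : X → ℝ := fun z => if C z then min (μx z) (μy z) else 0
  let α : Fin 3 → X → ℝ := ![fun z => if z = y then μx z else 0,
    fun z => if C z then μx z - min (μx z) (μy z) else 0,
    fun z => if z = y ∨ C z then 0 else μx z]
  let β : Fin 3 → X → ℝ := ![fun z => if z = x ∨ C z then 0 else μy z,
    fun z => if C z then μy z - min (μx z) (μy z) else 0,
    fun z => if z = x then μy z else 0]
  have hα : ∀ i u, 0 ≤ α i u := by
    intro i u
    have := hx0 u
    fin_cases i <;> simp [α] <;> split_ifs <;> simp [this]
  have hβ : ∀ i u, 0 ≤ β i u := by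
    intro i u
    have := hy0 u
    fin_cases i <;> simp [β] <;> split_ifs <;> simp [this]
  have hδ : ∀ u, 0 ≤ δ u := by
    intro u
    simp only [δ]
    split_ifs <;> simp [hx0 u, hy0 u]
  have hδs : ∀ u, δ u ≠ 0 → u ∈ s := fun u hu => hmins u fun h => hu (by simp [δ, h])
  have hαx : ∀ i u, α i u ≠ 0 → μx u ≠ 0 := by
    intro i u h h0
    have := hy0 u
    fin_cases i <;> simp [α, h0, this] at h
  have hβy : ∀ i u, β i u ≠ 0 → μy u ≠ 0 := by
    intro i u h h0
    have := hx0 u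
    fin_cases i <;> simp [β, h0, this] at h
  have hμ : ∀ u, ∑ i, α i u + δ u = μx u := by
    intro u
    have := hCy u
    simp only [Fin.sum_univ_three, α, δ, Matrix.cons_val]
    by_cases h1 : C u <;> by_cases h2 : u = y <;> simp_all
  have hν : ∀ u, ∑ i, β i u + δ u = μy u := by
    intro u
    have := hCx u
    simp only [Fin.sum_univ_three, β, δ, Matrix.cons_val]
    by_cases h1 : C u <;> by_cases h2 : u = x <;> simp_all
  have hsumx : ∑ u ∈ s, μx u = 1 := by
    rw [← hx1, finsum_eq_sum_of_support_subset _ hxs]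
  have hsumy : ∑ u ∈ s, μy u = 1 := by
    rw [← hy1, finsum_eq_sum_of_support_subset _ hys]
  have hp : ∑ i, ∑ u ∈ s, α i u + ∑ u ∈ s, δ u = 1 := by
    rw [Finset.sum_comm, ← Finset.sum_add_distrib, ← hsumx]
    exact Finset.sum_congr rfl fun u _ => hμ u
  have hq : ∑ j, ∑ u ∈ s, β j u + ∑ u ∈ s, δ u = 1 := by
    rw [Finset.sum_comm, ← Finset.sum_add_distrib, ← hsumy]
    exact Finset.sum_congr rfl fun u _ => hν u
  have hp0 : ∑ u ∈ s, α 0 u = μx y := by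
    simp only [α, Matrix.cons_val, Finset.sum_ite_eq']
    split_ifs with h
    · rfl
    · exact (not_not.1 (mt (hxs y) h)).symm
  have hq2 : ∑ u ∈ s, β 2 u = μy x := by
    simp only [β, Matrix.cons_val, Finset.sum_ite_eq']
    split_ifs with h
    · rfl
    · exact (not_not.1 (mt (hys x) h)).symm
  have hmin : (∑ᶠ z, if dist z x = 1 ∧ dist z y = 1 then min (μx z) (μy z) else 0) =
      ∑ u ∈ s, δ u :=
    finsum_eq_sum_of_support_subset _ hδs
  have hmax : (∑ᶠ z, if dist z x = 1 ∧ dist z y = 1 then max (μx z) (μy z) else 0) =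
      ∑ u ∈ s, α 1 u + ∑ u ∈ s, β 1 u + ∑ u ∈ s, δ u := by
    rw [finsum_eq_sum_of_support_subset (s := s) _
      fun u hu => hmaxs u fun h => hu (by simp [h]), ← Finset.sum_add_distrib,
      ← Finset.sum_add_distrib]
    refine Finset.sum_congr rfl fun u _ => ?_
    have := min_add_max (μx u) (μy u)
    simp only [α, β, δ, C, Matrix.cons_val]
    split_ifs <;> linarith
  have hcost : ∀ i j u v, α i u ≠ 0 → β j v ≠ 0 →
      dist u v ≤ (![![1, 1, 1], ![2, 2, 1], ![3, 2, 1]] : Fin 3 → Fin 3 → ℝ) i j := by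
    intro i j u v hu hv
    have hux := hsx u (hαx i u hu)
    have hvy := hsy v (hβy j v hv)
    have hu0 : i = 0 → u = y := by
      rintro rfl
      by_contra h
      exact hu (by simp [α, h])
    have hu1 : i = 1 → C u := by
      rintro rfl
      by_contra h
      exact hu (by simp [α, h])
    have hv1 : j = 1 → C v := by
      rintro rfl
      by_contra h
      exact hv (by simp [β, h])
    have hv2 : j = 2 → v = x := by
      rintro rfl
      by_contra h
      exact hv (by simp [β, h])
    have hyv : dist y v = 1 := by rw [dist_comm, hvy]
    have hxv : C v → dist x v = 1 := fun h => by rw [dist_comm, h.1]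
    have t1 := dist_triangle u x v
    have t2 := dist_triangle u y v
    have t3 := dist_triangle x y v
    have huy : C u → dist u y = 1 := fun h => h.2
    fin_cases i <;> fin_cases j <;> simp at hu0 hu1 hv1 hv2 ⊢ <;> grind
  obtain ⟨g, hg, hgp, hgq, hgc⟩ := exists_three_class_plan
    (fun i => Finset.sum_nonneg fun u (_ : u ∈ s) => hα i u)
    (fun j => Finset.sum_nonneg fun u (_ : u ∈ s) => hβ j u)
    (add_right_cancel (hp.trans hq.symm))
  refine (W1_le_sum_of_class_plan (d := fun u v => dist u v) (fun _ _ => dist_nonneg) dist_self s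
    α β δ g _ hα hβ hδ (fun i u h => hxs u (hαx i u h))
    (fun i u h => hys u (hβy i u h)) hδs hμ hν hg hgp hgq hcost).trans ?_
  rw [hgc, hmin, hmax]
  simp only [Fin.sum_univ_three, hp0, hq2] at hp hq ⊢
  refine le_of_eq ?_
  have e1 : ∑ u ∈ s, β 0 u + ∑ u ∈ s, β 1 u - μx y = 1 - μx y - μy x - ∑ u ∈ s, δ u := by
    linarith
  have e2 : ∑ u ∈ s, β 0 u - μx y - ∑ u ∈ s, α 1 u = 1 - μx y - μy x -
      (∑ u ∈ s, α 1 u + ∑ u ∈ s, β 1 u + ∑ u ∈ s, δ u) := by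
    linarith
  rw [e1, e2]
  linarith
end

section
/- Let (X, d) be a metric space in which the distance between any two distinct points is a positive integer, and let x, y ∈ X satisfy d(x, y) = 1. Let μ_x and μ_y be finitely supported probability measures on X with μ_x supported on {z : d(z, x) = 1} and μ_y supported on {z : d(z, y) = 1}. Then the Ollivier–Ricci curvature satisfies κ(x, y) ≥ − (1 − μ_x(y) − μ_y(x) − Σ_{z : d(z,x)=1, d(z,y)=1} max(μ_x(z), μ_y(z)))₊ − (1 − μ_x(y) − μ_y(x) − Σ_{z : d(z,x)=1, d(z,y)=1} min(μ_x(z), μ_y(z)))₊ + Σ_{z : d(z,x)=1, d(z,y)=1} min(μ_x(z), μ_y(z)). -/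
open scoped Classical

open Finset in
/-- Summing a function of the class of `u` against the normalized restriction of `A` to each
class gives the sum over the classes. -/
theorem sum_mul_div_fiber {X ι : Type*} [Fintype ι] [DecidableEq ι]
    (S : Finset X) (c : X → ι) (A : X → ℝ)
    (G : ι → ℝ) (hG : ∀ i, ∑ u ∈ S with c u = i, A u = 0 → G i = 0) :
    ∑ u ∈ S, G (c u) * (A u / ∑ w ∈ S with c w = c u, A w) = ∑ i, G i := by
  rw [← Finset.sum_fiberwise S c]
  refine Finset.sum_congr rfl fun i _ => ?_
  have h : ∀ u ∈ S.filter (fun u => c u = i),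
      G (c u) * (A u / ∑ w ∈ S with c w = c u, A w)
        = G i * (A u / ∑ w ∈ S with c w = i, A w) := by
    intro u hu
    rw [(Finset.mem_filter.1 hu).2]
  rw [Finset.sum_congr rfl h, ← Finset.mul_sum, ← Finset.sum_div]
  by_cases h0 : ∑ w ∈ S with c w = i, A w = 0
  · simp [hG i h0]
  · rw [div_self h0, mul_one]

/-- A finite transport plan bounds the Wasserstein distance from above. -/
theorem W1_le_sum {X : Type*} {d : X → X → ℝ} (hd : ∀ u v, 0 ≤ d u v) {μ ν : X → ℝ}
    (S : Finset X) (g : X → X → ℝ) (hg : ∀ u v, 0 ≤ g u v)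
    (hS : ∀ u v, g u v ≠ 0 → u ∈ S ∧ v ∈ S)
    (hμ : ∀ u, ∑ v ∈ S, g u v = μ u) (hν : ∀ v, ∑ u ∈ S, g u v = ν v) :
    W1 d μ ν ≤ ∑ u ∈ S, ∑ v ∈ S, d u v * g u v := by
  refine csInf_le ⟨0, ?_⟩ ⟨Finsupp.onFinset (S ×ˢ S) (fun p => g p.1 p.2)
    (fun p hp => Finset.mem_product.2 (hS _ _ hp)), fun p => hg _ _, fun u => ?_, fun v => ?_, ?_⟩
  · rintro _ ⟨γ, hγ, -, -, rfl⟩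
    exact finsum_nonneg fun p => mul_nonneg (hd _ _) (hγ p)
  · rw [← hμ u]
    exact finsum_eq_sum_of_support_subset _ fun v hv => (hS _ _ hv).2
  · rw [← hν v]
    exact finsum_eq_sum_of_support_subset _ fun u hu => (hS _ _ hu).1
  · rw [← Finset.sum_product' S S (fun u v => d u v * g u v)]
    refine (finsum_eq_sum_of_support_subset _ fun p hp => ?_).symm
    exact Finset.mem_coe.2 (Finset.mem_product.2 (hS _ _ (right_ne_zero_of_mul hp)))

open Finset in
/-- Keep the common mass `k` in place and move the remaining masses `A` and `B` between classes
of points according to the plan `t`, where moving from class `i` to class `j` costs at most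
`D i j` per unit of mass. -/
theorem W1_le_of_class_plan {X ι κ : Type*} [Fintype ι] [Fintype κ]
    [DecidableEq ι] [DecidableEq κ] {d : X → X → ℝ}
    (hd : ∀ u v, 0 ≤ d u v) (hd0 : ∀ u, d u u = 0) {k A B : X → ℝ}
    (hk : ∀ u, 0 ≤ k u) (hA : ∀ u, 0 ≤ A u) (hB : ∀ u, 0 ≤ B u) (S : Finset X)
    (hkS : ∀ u, k u ≠ 0 → u ∈ S) (hAS : ∀ u, A u ≠ 0 → u ∈ S) (hBS : ∀ u, B u ≠ 0 → u ∈ S)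
    (c : X → ι) (c' : X → κ) (t D : ι → κ → ℝ) (ht : ∀ i j, 0 ≤ t i j)
    (hrow : ∀ i, ∑ j, t i j = ∑ u ∈ S with c u = i, A u)
    (hcol : ∀ j, ∑ i, t i j = ∑ v ∈ S with c' v = j, B v)
    (hD : ∀ u v, A u ≠ 0 → B v ≠ 0 → d u v ≤ D (c u) (c' v)) :
    W1 d (fun u => k u + A u) (fun u => k u + B u) ≤ ∑ i, ∑ j, D i j * t i j := by
  set α : ι → ℝ := fun i => ∑ u ∈ S with c u = i, A u with hα
  set β : κ → ℝ := fun j => ∑ v ∈ S with c' v = j, B v with hβ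
  have htα : ∀ i, α i = 0 → ∀ j, t i j = 0 := fun i hi j =>
    (Finset.sum_eq_zero_iff_of_nonneg fun j _ => ht i j).1 ((hrow i).trans hi) j (mem_univ j)
  have htβ : ∀ j, β j = 0 → ∀ i, t i j = 0 := fun j hj i =>
    (Finset.sum_eq_zero_iff_of_nonneg fun i _ => ht i j).1 ((hcol j).trans hj) i (mem_univ i)
  have hα0 : ∀ i, 0 ≤ α i := fun i => sum_nonneg fun u _ => hA u
  have hβ0 : ∀ j, 0 ≤ β j := fun j => sum_nonneg fun v _ => hB v
  set f : X → X → ℝ := fun u v => t (c u) (c' v) * (A u / α (c u)) * (B v / β (c' v)) with hf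
  have hf0 : ∀ u v, 0 ≤ f u v := fun u v =>
    mul_nonneg (mul_nonneg (ht _ _) (div_nonneg (hA u) (hα0 _))) (div_nonneg (hB v) (hβ0 _))
  have hfA : ∀ u v, f u v ≠ 0 → A u ≠ 0 := by
    intro u v h h0
    exact h (by simp [hf, h0])
  have hfB : ∀ u v, f u v ≠ 0 → B v ≠ 0 := by
    intro u v h h0
    exact h (by simp [hf, h0])
  have hA_norm : ∀ u, α (c u) * (A u / α (c u)) = A u := by
    intro u
    refine mul_div_cancel_of_imp' fun h => by_contra fun hu => hu ?_
    exact (Finset.sum_eq_zero_iff_of_nonneg fun u _ => hA u).1 h u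
      (mem_filter.2 ⟨hAS u hu, rfl⟩)
  have hB_norm : ∀ v, β (c' v) * (B v / β (c' v)) = B v := by
    intro v
    refine mul_div_cancel_of_imp' fun h => by_contra fun hv => hv ?_
    exact (Finset.sum_eq_zero_iff_of_nonneg fun v _ => hB v).1 h v
      (mem_filter.2 ⟨hBS v hv, rfl⟩)
  have hf_row : ∀ u, ∑ v ∈ S, f u v = A u := by
    intro u
    have h := sum_mul_div_fiber S c' B (fun j => t (c u) j * (A u / α (c u)))
      (fun j hj => by simp [htβ j hj])
    refine h.trans ?_
    rw [← Finset.sum_mul, hrow]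
    exact hA_norm u
  have hf_col : ∀ v, ∑ u ∈ S, f u v = B v := by
    intro v
    have h := sum_mul_div_fiber S c A (fun i => t i (c' v) * (B v / β (c' v)))
      (fun i hi => by simp [htα i hi])
    refine (Finset.sum_congr rfl fun u _ => ?_).trans (h.trans ?_)
    · simp only [hf, hα]
      ring
    · rw [← Finset.sum_mul, hcol]
      exact hB_norm v
  have hf_cost : ∑ u ∈ S, ∑ v ∈ S, D (c u) (c' v) * f u v = ∑ i, ∑ j, D i j * t i j := by
    have h : ∀ u, ∑ v ∈ S, D (c u) (c' v) * f u v
        = (∑ j, D (c u) j * t (c u) j) * (A u / α (c u)) := by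
      intro u
      have h := sum_mul_div_fiber S c' B (fun j => D (c u) j * t (c u) j * (A u / α (c u)))
        (fun j hj => by simp [htβ j hj])
      rw [Finset.sum_mul, ← h]
      refine Finset.sum_congr rfl fun v _ => ?_
      simp only [hf, hβ]
      ring
    simp_rw [h]
    exact sum_mul_div_fiber S c A (fun i => ∑ j, D i j * t i j)
      (fun i hi => by simp [htα i hi])
  have hdiag : ∀ u v, (if u = v then k u else 0) ≠ 0 → u ∈ S ∧ v ∈ S := by
    intro u v h
    obtain ⟨rfl, hu⟩ := ite_ne_right_iff.1 h
    exact ⟨hkS u hu, hkS u hu⟩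
  have hk_mem : ∀ u, (if u ∈ S then k u else 0) = k u := by
    intro u
    split_ifs with h
    · rfl
    · exact (by_contra fun h0 => h (hkS u (Ne.symm h0)))
  refine (W1_le_sum hd S (fun u v => (if u = v then k u else 0) + f u v) ?_ ?_ ?_ ?_).trans ?_
  · intro u v
    refine add_nonneg ?_ (hf0 u v)
    split_ifs
    exacts [hk u, le_rfl]
  · intro u v h
    by_cases h1 : (if u = v then k u else 0) = 0
    · have h2 : f u v ≠ 0 := fun h2 => h (by simp only [h1, h2, add_zero])
      exact ⟨hAS u (hfA u v h2), hBS v (hfB u v h2)⟩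
    · exact hdiag u v h1
  · intro u
    rw [Finset.sum_add_distrib, hf_row, Finset.sum_ite_eq, hk_mem]
  · intro v
    rw [Finset.sum_add_distrib, hf_col, Finset.sum_ite_eq', hk_mem]
  · rw [← hf_cost]
    refine Finset.sum_le_sum fun u _ => Finset.sum_le_sum fun v _ => ?_
    have h1 : d u v * (if u = v then k u else 0) = 0 := by
      split_ifs with h
      · rw [← h, hd0, zero_mul]
      · exact mul_zero _
    rw [mul_add, h1, zero_add]
    by_cases h2 : f u v = 0
    · rw [h2, mul_zero, mul_zero]
    · exact mul_le_mul_of_nonneg_right (hD u v (hfA u v h2) (hfB u v h2)) (hf0 u v)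

/-- The antimonotone coupling of two mass vectors on three classes, and its cost. -/
theorem exists_antimonotone_plan (α β : Fin 3 → ℝ) (hα : ∀ i, 0 ≤ α i) (hβ : ∀ j, 0 ≤ β j)
    (hsum : ∑ i, α i = ∑ j, β j) :
    ∃ t : Fin 3 → Fin 3 → ℝ, (∀ i j, 0 ≤ t i j) ∧ (∀ i, ∑ j, t i j = α i) ∧
      (∀ j, ∑ i, t i j = β j) ∧
      ∑ i, ∑ j, (!![1, 1, 1; 1, 2, 2; 1, 2, 3] : Matrix (Fin 3) (Fin 3) ℝ) i j * t i j
        = ∑ i, α i + max (α 2 - β 0 - β 1) 0 + max (α 1 + α 2 - β 0) 0 := by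
  have ha0 := hα 0
  have ha1 := hα 1
  have ha2 := hα 2
  have hb0 := hβ 0
  have hb1 := hβ 1
  have hb2 := hβ 2
  simp only [Fin.sum_univ_three] at hsum
  set w := max (α 2 - β 0 - β 1) 0 with hw
  set r := max (α 2 - β 0) 0 with hr
  set s := max (α 1 + α 2 - β 0 - β 1) 0 with hs
  set v := max (α 1 + α 2 - β 0) 0 with hv
  refine ⟨!![β 0 - (α 1 + α 2 - v), β 1 - (v - s), β 2 - s;
      (α 1 + α 2 - v) - (α 2 - r), (v - s) - (r - w), s - w;
      α 2 - r, r - w, w], ?_, ?_, ?_, ?_⟩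
  · intro i j
    fin_cases i <;> fin_cases j <;> simp <;> grind
  · intro i
    fin_cases i <;> simp [Fin.sum_univ_three] <;> linarith
  · intro j
    fin_cases j <;> simp [Fin.sum_univ_three]
  · simp [Fin.sum_univ_three]
    linarith

/-- Lower bound on the Ollivier–Ricci curvature `κ(x,y) = 1 - W₁(μx, μy)` at adjacent
points of a metric space with integer-valued distances. -/
theorem orc_lower_bound {X : Type*} [MetricSpace X]
    (hint : ∀ u v : X, u ≠ v → ∃ n : ℕ, 0 < n ∧ dist u v = n)
    (x y : X) (hxy : dist x y = 1)
    (μx μy : X → ℝ) (hμx : IsFinProb μx) (hμy : IsFinProb μy)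
    (hsx : ∀ z, μx z ≠ 0 → dist z x = 1)
    (hsy : ∀ z, μy z ≠ 0 → dist z y = 1) :
    1 - W1 (fun u v => dist u v) μx μy ≥
      - max (1 - μx y - μy x -
            ∑ᶠ z, if dist z x = 1 ∧ dist z y = 1 then max (μx z) (μy z) else 0) 0
        - max (1 - μx y - μy x -
            ∑ᶠ z, if dist z x = 1 ∧ dist z y = 1 then min (μx z) (μy z) else 0) 0
        + ∑ᶠ z, if dist z x = 1 ∧ dist z y = 1 then min (μx z) (μy z) else 0 := by
  obtain ⟨hx0, hxfin, hxsum⟩ := hμx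
  obtain ⟨hy0, hyfin, hysum⟩ := hμy
  set S : Finset X := insert x (insert y (hxfin.toFinset ∪ hyfin.toFinset)) with hS
  have hxS : ∀ u, μx u ≠ 0 → u ∈ S := fun u hu => by simp [hS, hu]
  have hyS : ∀ u, μy u ≠ 0 → u ∈ S := fun u hu => by simp [hS, hu]
  have hxx : μx x = 0 := by_contra fun h => by simpa using hsx x h
  have hyy : μy y = 0 := by_contra fun h => by simpa using hsy y h
  set k : X → ℝ := fun u => min (μx u) (μy u) with hk
  have hk0 : ∀ u, 0 ≤ k u := fun u => le_min (hx0 u) (hy0 u)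
  have hkx : ∀ u, k u ≠ 0 → μx u ≠ 0 := fun u h h0 => h (by simp [hk, h0, hy0 u])
  have hky : ∀ u, k u ≠ 0 → μy u ≠ 0 := fun u h h0 => h (by simp [hk, h0, hx0 u])
  set A : X → ℝ := fun u => μx u - k u with hA
  set B : X → ℝ := fun u => μy u - k u with hB
  have hA0 : ∀ u, 0 ≤ A u := fun u => sub_nonneg.2 (min_le_left _ _)
  have hB0 : ∀ u, 0 ≤ B u := fun u => sub_nonneg.2 (min_le_right _ _)
  have hAx : ∀ u, A u ≠ 0 → μx u ≠ 0 := fun u h h0 => h (by simp [hA, hk, h0, hy0 u])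
  have hBy : ∀ u, B u ≠ 0 → μy u ≠ 0 := fun u h h0 => h (by simp [hB, hk, h0, hx0 u])
  set c : X → Fin 3 := fun u =>
    if u = y then 0 else if dist u x = 1 ∧ dist u y = 1 then 1 else 2 with hc
  set c' : X → Fin 3 := fun u =>
    if u = x then 0 else if dist u x = 1 ∧ dist u y = 1 then 1 else 2 with hc'
  have hc0 : ∀ u, c u = 0 ↔ u = y := by
    intro u
    simp only [hc]
    split_ifs with h1 h2 <;> simp [h1]
  have hc'0 : ∀ u, c' u = 0 ↔ u = x := by
    intro u
    simp only [hc']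
    split_ifs with h1 h2 <;> simp [h1]
  have hc1 : ∀ u, c u = 1 ↔ dist u x = 1 ∧ dist u y = 1 := by
    intro u
    simp only [hc]
    split_ifs with h1 h2
    · simp [h1]
    · simp [h2]
    · simp [h2]
  have hc'1 : ∀ u, c' u = 1 ↔ dist u x = 1 ∧ dist u y = 1 := by
    intro u
    simp only [hc']
    split_ifs with h1 h2
    · simp [h1]
    · simp [h2]
    · simp [h2]
  set α : Fin 3 → ℝ := fun i => ∑ u ∈ S with c u = i, A u with hα
  set β : Fin 3 → ℝ := fun j => ∑ v ∈ S with c' v = j, B v with hβ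
  have hα0 : α 0 = μx y := by
    have h : S.filter (fun u => c u = 0) = {y} := by
      ext u
      simp only [Finset.mem_filter, hc0, Finset.mem_singleton]
      exact ⟨fun h => h.2, fun h => ⟨by simp [hS, h], h⟩⟩
    simp only [hα, h, Finset.sum_singleton, hA, hk, hyy, min_eq_right (hx0 y), sub_zero]
  have hβ0 : β 0 = μy x := by
    have h : S.filter (fun u => c' u = 0) = {x} := by
      ext u
      simp only [Finset.mem_filter, hc'0, Finset.mem_singleton]
      exact ⟨fun h => h.2, fun h => ⟨by simp [hS, h], h⟩⟩
    simp only [hβ, h, Finset.sum_singleton, hB, hk, hxx, min_eq_left (hy0 x), sub_zero]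
  have hxsum' : ∑ u ∈ S, μx u = 1 := by
    rw [← hxsum]
    exact (finsum_eq_sum_of_support_subset _ fun u hu => hxS u hu).symm
  have hysum' : ∑ u ∈ S, μy u = 1 := by
    rw [← hysum]
    exact (finsum_eq_sum_of_support_subset _ fun u hu => hyS u hu).symm
  have hmin : (∑ᶠ z, if dist z x = 1 ∧ dist z y = 1 then min (μx z) (μy z) else 0)
      = ∑ u ∈ S, k u := by
    rw [← finsum_eq_sum_of_support_subset k fun u hu => hxS u (hkx u hu)]
    refine finsum_congr fun u => ?_
    split_ifs with h
    · rfl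
    · exact by_contra fun h0 => h ⟨hsx u (hkx u (Ne.symm h0)), hsy u (hky u (Ne.symm h0))⟩
  have hmax : (∑ᶠ z, if dist z x = 1 ∧ dist z y = 1 then max (μx z) (μy z) else 0)
      = ∑ u ∈ S, k u + α 1 + β 1 := by
    rw [finsum_eq_sum_of_support_subset (s := S), ← hmin,
      finsum_eq_sum_of_support_subset (s := S)]
    · simp only [hα, hβ, hc1, hc'1, Finset.sum_filter, ← Finset.sum_add_distrib]
      refine Finset.sum_congr rfl fun u _ => ?_
      split_ifs
      · simp only [hA, hB, hk]
        linarith [min_add_max (μx u) (μy u)]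
      · simp
    · intro u hu
      exact hxS u (hkx u (ite_ne_right_iff.1 hu).2)
    · intro u hu
      have hu' := (ite_ne_right_iff.1 hu).2
      by_cases h : μx u = 0
      · exact hyS u fun h' => hu' (by simp [h, h'])
      · exact hxS u h
  have hαsum : ∑ i, α i = 1 - ∑ u ∈ S, k u := by
    rw [← hxsum', ← Finset.sum_sub_distrib]
    exact Finset.sum_fiberwise S c A
  have hβsum : ∑ j, β j = 1 - ∑ u ∈ S, k u := by
    rw [← hysum', ← Finset.sum_sub_distrib]
    exact Finset.sum_fiberwise S c' B
  obtain ⟨t, ht, hrow, hcol, hcost⟩ := exists_antimonotone_plan α β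
    (fun i => Finset.sum_nonneg fun u _ => hA0 u) (fun j => Finset.sum_nonneg fun u _ => hB0 u)
    (hαsum.trans hβsum.symm)
  have hD : ∀ u v, A u ≠ 0 → B v ≠ 0 →
      dist u v ≤ (!![1, 1, 1; 1, 2, 2; 1, 2, 3] : Matrix (Fin 3) (Fin 3) ℝ) (c u) (c' v) := by
    intro u v hu hv
    have hux := hsx u (hAx u hu)
    have hvy := hsy v (hBy v hv)
    have h3 : dist u v ≤ dist u x + dist x y + dist y v := dist_triangle4 u x y v
    have huy := dist_triangle u y v
    have hxv := dist_triangle u x v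
    rw [dist_comm y v] at h3 huy
    rw [dist_comm x v] at hxv
    simp only [hc, hc']
    split_ifs with h1 h2 h4 h2 h4 h5 h4 h6 <;> simp <;> grind [dist_self, dist_comm]
  have hW := W1_le_of_class_plan (d := fun u v : X => dist u v) (fun u v => dist_nonneg)
    (fun u => dist_self u) hk0 hA0 hB0 S (fun u h => hxS u (hkx u h)) (fun u h => hxS u (hAx u h))
    (fun u h => hyS u (hBy u h)) c c' t _ ht hrow hcol hD
  rw [hcost] at hW
  simp only [hA, hB, add_sub_cancel] at hW
  rw [hmin, hmax]
  rw [hαsum] at hW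
  rw [Fin.sum_univ_three] at hαsum hβsum
  have e1 : α 2 - β 0 - β 1 = 1 - μx y - μy x - (∑ u ∈ S, k u + α 1 + β 1) := by linarith
  have e2 : α 1 + α 2 - β 0 = 1 - μx y - μy x - ∑ u ∈ S, k u := by linarith
  rw [e1, e2] at hW
  linarith
end

section
/- Let (X, d) be a metric space in which the distance between any two distinct points is a positive integer, and let x, y ∈ X satisfy d(x, y) = 1. Let μ_x and μ_y be finitely supported probability measures on X with μ_x supported on {x} ∪ {z : d(z, x) = 1} and μ_y supported on {y} ∪ {z : d(z, y) = 1}, and suppose α := μ_x(x) satisfies μ_x(x) ≤ μ_y(y) and α < 1. Define ν_x = (μ_x − α δ_x)/(1 − α) and ν_y = (μ_y − α δ_y)/(1 − α). Then the Ollivier–Ricci curvature satisfies κ(x, y) ≥ (1 − α) · [− (1 − ν_x(y) − ν_y(x) − Σ_{z : d(z,x)=1, d(z,y)=1} max(ν_x(z), ν_y(z)))₊ − (1 − ν_x(y) − ν_y(x) − Σ_{z : d(z,x)=1, d(z,y)=1} min(ν_x(z), ν_y(z)))₊ + Σ_{z : d(z,x)=1, d(z,y)=1} min(ν_x(z), ν_y(z))].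 -/
open scoped Classical

section Coupling

variable {X ι κ : Type*}

/-- An explicit coupling carried by a finite set bounds the Wasserstein distance from above. -/
theorem W1_le_of_coupling {d : X → X → ℝ} (hd : ∀ u v, 0 ≤ d u v) {μ ν : X → ℝ}
    (S : Finset X) (γ : X → X → ℝ) (hγ : ∀ u v, 0 ≤ γ u v)
    (hS : ∀ u v, γ u v ≠ 0 → u ∈ S ∧ v ∈ S)
    (hμ : ∀ u, ∑ v ∈ S, γ u v = μ u) (hν : ∀ v, ∑ u ∈ S, γ u v = ν v) :
    W1 d μ ν ≤ ∑ u ∈ S, ∑ v ∈ S, d u v * γ u v := by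
  refine csInf_le ⟨0, ?_⟩ ⟨Finsupp.onFinset (S ×ˢ S) (fun p => γ p.1 p.2)
    (fun p hp => Finset.mem_product.2 (hS _ _ hp)), fun p => hγ _ _, fun u => ?_, fun v => ?_, ?_⟩
  · rintro c ⟨γ', h0, -, -, rfl⟩
    exact finsum_nonneg fun p => mul_nonneg (hd _ _) (h0 p)
  · rw [← hμ u]
    exact finsum_eq_sum_of_support_subset _ fun v hv => (hS u v hv).2
  · rw [← hν v]
    exact finsum_eq_sum_of_support_subset _ fun u hu => (hS u v hu).1
  · rw [← Finset.sum_product']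
    refine (finsum_eq_sum_of_support_subset _ fun p hp => ?_).symm
    exact Finset.mem_product.2 (hS _ _ (right_ne_zero_of_mul hp))

/-- Replacing the mass of every fibre of `j` by a prescribed one. -/
theorem sum_mul_fiber_div [Fintype κ] [DecidableEq κ] (S : Finset X) (g : X → ℝ) (j : X → κ) (G h : κ → ℝ)
    (hG : ∀ b, G b = ∑ v ∈ S with j v = b, g v) (h0 : ∀ b, G b = 0 → h b = 0) :
    ∑ v ∈ S, g v * (h (j v) / G (j v)) = ∑ b, h b := by
  rw [← Finset.sum_fiberwise S j]
  refine Finset.sum_congr rfl fun b _ => ?_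
  calc ∑ v ∈ S with j v = b, g v * (h (j v) / G (j v))
      = ∑ v ∈ S with j v = b, g v * (h b / G b) := by
        refine Finset.sum_congr rfl fun v hv => ?_
        rw [(Finset.mem_filter.1 hv).2]
    _ = G b * (h b / G b) := by rw [← Finset.sum_mul, ← hG]
    _ = h b := by
        by_cases hb : G b = 0
        · simp [hb, h0 b hb]
        · field_simp

/-- A transport plan between the classes of two partitions lifts to a coupling of the masses. -/
theorem exists_coupling_of_blocks [Fintype ι] [DecidableEq ι] [Fintype κ] [DecidableEq κ]
    (S : Finset X) (f g : X → ℝ)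
    (hf : ∀ u, 0 ≤ f u) (hg : ∀ v, 0 ≤ g v) (i : X → ι) (j : X → κ) (c : ι → κ → ℝ)
    (hfS : ∀ u, f u ≠ 0 → u ∈ S) (hgS : ∀ v, g v ≠ 0 → v ∈ S)
    (hc : ∀ a b, 0 ≤ c a b)
    (hrow : ∀ a, ∑ b, c a b = ∑ u ∈ S with i u = a, f u)
    (hcol : ∀ b, ∑ a, c a b = ∑ v ∈ S with j v = b, g v) :
    ∃ γ : X → X → ℝ, (∀ u v, 0 ≤ γ u v) ∧ (∀ u v, γ u v ≠ 0 → f u ≠ 0 ∧ g v ≠ 0) ∧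
      (∀ u, ∑ v ∈ S, γ u v = f u) ∧ (∀ v, ∑ u ∈ S, γ u v = g v) ∧
      ∀ k : ι → κ → ℝ,
        ∑ u ∈ S, ∑ v ∈ S, k (i u) (j v) * γ u v = ∑ a, ∑ b, k a b * c a b := by
  set F : ι → ℝ := fun a => ∑ b, c a b with hF
  set G : κ → ℝ := fun b => ∑ a, c a b with hG
  have hF0 : ∀ a, 0 ≤ F a := fun a => Finset.sum_nonneg fun b _ => hc a b
  have hG0 : ∀ b, 0 ≤ G b := fun b => Finset.sum_nonneg fun a _ => hc a b
  have hFc : ∀ a b, F a = 0 → c a b = 0 := fun a b h =>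
    (Finset.sum_eq_zero_iff_of_nonneg fun b _ => hc a b).1 h b (Finset.mem_univ b)
  have hGc : ∀ a b, G b = 0 → c a b = 0 := fun a b h =>
    (Finset.sum_eq_zero_iff_of_nonneg fun a _ => hc a b).1 h a (Finset.mem_univ a)
  have hfF : ∀ u, F (i u) = 0 → f u = 0 := fun u h => by
    by_contra hne
    exact hne <| (Finset.sum_eq_zero_iff_of_nonneg fun w _ => hf w).1
      ((hrow (i u)).symm.trans h) u (Finset.mem_filter.2 ⟨hfS u hne, rfl⟩)
  have hgG : ∀ v, G (j v) = 0 → g v = 0 := fun v h => by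
    by_contra hne
    exact hne <| (Finset.sum_eq_zero_iff_of_nonneg fun w _ => hg w).1
      ((hcol (j v)).symm.trans h) v (Finset.mem_filter.2 ⟨hgS v hne, rfl⟩)
  refine ⟨fun u v => f u * g v * c (i u) (j v) / (F (i u) * G (j v)), fun u v => ?_,
    fun u v h => ?_, fun u => ?_, fun v => ?_, fun k => ?_⟩
  · exact div_nonneg (mul_nonneg (mul_nonneg (hf u) (hg v)) (hc _ _))
      (mul_nonneg (hF0 _) (hG0 _))
  · constructor <;> rintro h0 <;> simp [h0] at h
  · have := sum_mul_fiber_div S g j G (c (i u)) hcol (hGc (i u))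
    calc _ = f u / F (i u) * ∑ v ∈ S, g v * (c (i u) (j v) / G (j v)) := by
          rw [Finset.mul_sum]
          refine Finset.sum_congr rfl fun v _ => ?_
          simp only [div_eq_mul_inv, mul_inv]; ring
      _ = f u := by
          rw [this]
          exact div_mul_cancel_of_imp (hfF u)
  · have := sum_mul_fiber_div S f i F (fun a => c a (j v)) hrow (fun a => hFc a (j v))
    calc _ = g v / G (j v) * ∑ u ∈ S, f u * (c (i u) (j v) / F (i u)) := by
          rw [Finset.mul_sum]
          refine Finset.sum_congr rfl fun u _ => ?_
          simp only [div_eq_mul_inv, mul_inv]; ring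
      _ = g v := by
          rw [this]
          exact div_mul_cancel_of_imp (hgG v)
  · rw [← sum_mul_fiber_div S f i F (fun a => ∑ b, k a b * c a b) hrow
      (fun a h => Finset.sum_eq_zero fun b _ => by rw [hFc a b h, mul_zero])]
    refine Finset.sum_congr rfl fun u _ => ?_
    rw [← sum_mul_fiber_div S g j G (fun b => k (i u) b * c (i u) b) hcol
      (fun b h => by rw [hGc _ b h, mul_zero]), Finset.sum_div, Finset.mul_sum]
    refine Finset.sum_congr rfl fun v _ => ?_
    simp only [div_eq_mul_inv, mul_inv]; ring

/-- The positive part is convex: its second differences are nonnegative. -/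
theorem max_zero_second_diff_nonneg (t : ℝ) {a b : ℝ} (ha : 0 ≤ a) (hb : 0 ≤ b) :
    0 ≤ max t 0 - max (t - a) 0 - max (t - b) 0 + max (t - a - b) 0 := by
  rcases max_cases t 0 with h | h <;> rcases max_cases (t - a) 0 with h' | h' <;>
    rcases max_cases (t - b) 0 with h'' | h'' <;>
    rcases max_cases (t - a - b) 0 with h3 | h3 <;> linarith

/-- The countermonotone plan between two three-atom mass vectors: it minimizes the mass of all
lower right corners simultaneously. -/
theorem exists_countermonotone_plan (F G : Fin 3 → ℝ) (hF : ∀ a, 0 ≤ F a) (hG : ∀ b, 0 ≤ G b)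
    (hFG : ∑ a, F a = ∑ b, G b) :
    ∃ c : Fin 3 → Fin 3 → ℝ, (∀ a b, 0 ≤ c a b) ∧ (∀ a, ∑ b, c a b = F a) ∧
      (∀ b, ∑ a, c a b = G b) ∧
      c 1 1 + c 1 2 + c 2 1 + c 2 2 = max (∑ a, F a - F 0 - G 0) 0 ∧
      c 2 2 = max (∑ a, F a - F 0 - F 1 - G 0 - G 1) 0 := by
  set A : Fin 4 → ℝ := ![0, F 0, F 0 + F 1, F 0 + F 1 + F 2] with hA
  set B : Fin 4 → ℝ := ![0, G 0, G 0 + G 1, G 0 + G 1 + G 2] with hB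
  set h : Fin 4 → Fin 4 → ℝ := fun a b => max (∑ a, F a - A a - B b) 0 with hh
  have hAs : ∀ a : Fin 3, A a.succ = A a.castSucc + F a := by
    intro a; fin_cases a <;> simp [hA]
  have hBs : ∀ a : Fin 3, B a.succ = B a.castSucc + G a := by
    intro a; fin_cases a <;> simp [hB]
  have F0 := hF 0
  have F1 := hF 1
  have F2 := hF 2
  have G0 := hG 0
  have G1 := hG 1
  have G2 := hG 2
  simp only [Fin.sum_univ_three] at hFG
  have hr : ∀ a, h a 3 = 0 := by
    intro a
    simp only [hh, Fin.sum_univ_three]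
    apply max_eq_right
    fin_cases a <;> simp [hA, hB] <;> linarith
  have hl : ∀ b, h 3 b = 0 := by
    intro a
    simp only [hh, Fin.sum_univ_three]
    apply max_eq_right
    fin_cases a <;> simp [hA, hB] <;> linarith
  have hr0 : ∀ a, h a 0 = ∑ a, F a - A a := by
    intro a
    simp only [hh, Fin.sum_univ_three]
    rw [max_eq_left] <;> fin_cases a <;> simp [hA, hB] <;> linarith
  have hl0 : ∀ b, h 0 b = ∑ a, F a - B b := by
    intro a
    simp only [hh, Fin.sum_univ_three]
    rw [max_eq_left] <;> fin_cases a <;> simp [hA, hB] <;> linarith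
  refine ⟨fun a b => h a.castSucc b.castSucc - h a.succ b.castSucc - h a.castSucc b.succ
    + h a.succ b.succ, fun a b => ?_, fun a => ?_, fun b => ?_, ?_, ?_⟩
  · have := max_zero_second_diff_nonneg (∑ a, F a - A a.castSucc - B b.castSucc) (hF a) (hG b)
    simp only [hh, hAs, hBs, sub_add_eq_sub_sub]
    rwa [sub_right_comm _ (F a)]
  · have e1 := hr0 a.castSucc
    have e2 := hr0 a.succ
    have e3 := hr a.castSucc
    have e4 := hr a.succ
    have e5 := hAs a
    rw [Fin.sum_univ_three]
    change h a.castSucc 0 - h a.succ 0 - h a.castSucc 1 + h a.succ 1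
      + (h a.castSucc 1 - h a.succ 1 - h a.castSucc 2 + h a.succ 2)
      + (h a.castSucc 2 - h a.succ 2 - h a.castSucc 3 + h a.succ 3) = F a
    linarith
  · have e1 := hl0 b.castSucc
    have e2 := hl0 b.succ
    have e3 := hl b.castSucc
    have e4 := hl b.succ
    have e5 := hBs b
    rw [Fin.sum_univ_three]
    change h 0 b.castSucc - h 1 b.castSucc - h 0 b.succ + h 1 b.succ
      + (h 1 b.castSucc - h 2 b.castSucc - h 1 b.succ + h 2 b.succ)
      + (h 2 b.castSucc - h 3 b.castSucc - h 2 b.succ + h 3 b.succ) = G b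
    linarith
  · have e : h 1 1 = max (∑ a, F a - F 0 - G 0) 0 := rfl
    rw [← e]
    change h 1 1 - h 2 1 - h 1 2 + h 2 2 + (h 1 2 - h 2 2 - h 1 3 + h 2 3)
      + (h 2 1 - h 3 1 - h 2 2 + h 3 2) + (h 2 2 - h 3 2 - h 2 3 + h 3 3) = h 1 1
    linarith [hr 1, hr 2, hr 3, hl 1]
  · have e : h 2 2 = max (∑ a, F a - F 0 - F 1 - G 0 - G 1) 0 := by
      simp only [hh]
      congr 1
      simp [hA, hB]
      ring
    rw [← e]
    change h 2 2 - h 3 2 - h 2 3 + h 3 3 = h 2 2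
    linarith [hr 2, hr 3, hl 2]

end Coupling

/-- The transport cost between a mass `f` on the unit sphere around `x` and a mass `g` on the unit
ball around `y` without its centre, of the same total mass. -/
theorem exists_coupling_of_adjacent {X : Type*} [MetricSpace X] {x y : X} (hxy : dist x y = 1)
    (S : Finset X) (hxS : x ∈ S) (hyS : y ∈ S) (f g : X → ℝ)
    (hf : ∀ u, 0 ≤ f u) (hg : ∀ v, 0 ≤ g v)
    (hfS : ∀ u, f u ≠ 0 → u ∈ S) (hgS : ∀ v, g v ≠ 0 → v ∈ S)
    (hfx : ∀ u, f u ≠ 0 → dist u x = 1) (hgy : ∀ v, g v ≠ 0 → v = y ∨ dist v y = 1)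
    (hfg : ∑ u ∈ S, f u = ∑ v ∈ S, g v) :
    ∃ γ : X → X → ℝ, (∀ u v, 0 ≤ γ u v) ∧ (∀ u v, γ u v ≠ 0 → u ∈ S ∧ v ∈ S) ∧
      (∀ u, ∑ v ∈ S, γ u v = f u) ∧ (∀ v, ∑ u ∈ S, γ u v = g v) ∧
      ∑ u ∈ S, ∑ v ∈ S, dist u v * γ u v ≤ ∑ u ∈ S, f u
        + max (∑ u ∈ S, f u - f y - g x) 0
        + max (∑ u ∈ S, f u - f y - g x
            - ∑ z ∈ S with dist z x = 1 ∧ dist z y = 1, (f z + g z)) 0 := by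
  let i : X → Fin 3 := fun z => if z = y then 0 else if dist z x = 1 ∧ dist z y = 1 then 1 else 2
  let j : X → Fin 3 := fun z => if z = x then 0 else if dist z x = 1 ∧ dist z y = 1 then 1 else 2
  have hi0 : ∀ z, i z = 0 ↔ z = y := fun z => by
    simp only [i]; split_ifs <;> simp_all
  have hj0 : ∀ z, j z = 0 ↔ z = x := fun z => by
    simp only [j]; split_ifs <;> simp_all
  have hi1 : ∀ z, i z = 1 ↔ dist z x = 1 ∧ dist z y = 1 := fun z => by
    simp only [i]; split_ifs <;> simp_all
  have hj1 : ∀ z, j z = 1 ↔ dist z x = 1 ∧ dist z y = 1 := fun z => by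
    simp only [j]; split_ifs <;> simp_all
  obtain ⟨c, hc, hrow, hcol, h1, h2⟩ := exists_countermonotone_plan
    (fun a => ∑ u ∈ S with i u = a, f u) (fun b => ∑ v ∈ S with j v = b, g v)
    (fun a => Finset.sum_nonneg fun u _ => hf u) (fun b => Finset.sum_nonneg fun v _ => hg v)
    (by rw [Finset.sum_fiberwise, Finset.sum_fiberwise, hfg])
  obtain ⟨γ, hγ, hγ0, hγf, hγg, hcost⟩ :=
    exists_coupling_of_blocks S f g hf hg i j c hfS hgS hc hrow hcol
  refine ⟨γ, hγ, fun u v h => ⟨hfS u (hγ0 u v h).1, hgS v (hγ0 u v h).2⟩, hγf, hγg, ?_⟩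
  have hF0 : ∑ u ∈ S with i u = 0, f u = f y := by
    rw [Finset.sum_filter, Finset.sum_eq_single_of_mem y hyS fun u _ hu =>
      if_neg (mt (hi0 u).1 hu), if_pos ((hi0 y).2 rfl)]
  have hG0 : ∑ v ∈ S with j v = 0, g v = g x := by
    rw [Finset.sum_filter, Finset.sum_eq_single_of_mem x hxS fun v _ hv =>
      if_neg (mt (hj0 v).1 hv), if_pos ((hj0 x).2 rfl)]
  simp only [hF0, hG0, hi1, hj1, Finset.sum_fiberwise] at h1 h2
  have htot : ∑ a, ∑ b, c a b = ∑ u ∈ S, f u := by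
    simp only [hrow, Finset.sum_fiberwise]
  simp only [Fin.sum_univ_three] at htot
  let k : Fin 3 → Fin 3 → ℝ := ![![1, 1, 1], ![1, 2, 2], ![1, 2, 3]]
  have hk : ∀ u v, f u ≠ 0 → g v ≠ 0 → dist u v ≤ k (i u) (j v) := by
    intro u v hu hv
    have hux := hfx u hu
    have hvy := hgy v hv
    have hvy' : dist y v ≤ 1 := by
      rcases hvy with rfl | h
      · simp
      · rw [dist_comm, h]
    have t1 := dist_triangle u x v
    have t2 := dist_triangle u y v
    have t3 := dist_triangle x y v
    by_cases huy : u = y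
    · have hiu : i u = 0 := (hi0 u).2 huy
      have hk1 : k 0 (j v) = 1 := by generalize j v = b; fin_cases b <;> rfl
      rw [hiu, hk1, huy]
      exact hvy'
    by_cases hvx : v = x
    · have hjv : j v = 0 := (hj0 v).2 hvx
      have hk1 : k (i u) 0 = 1 := by generalize i u = b; fin_cases b <;> rfl
      rw [hjv, hk1, hvx]
      exact hux.le
    by_cases hu1 : dist u x = 1 ∧ dist u y = 1
    · have hk1 : 2 ≤ k (i u) (j v) := by
        have hjv : j v ≠ 0 := fun h => hvx ((hj0 v).1 h)
        rw [(hi1 u).2 hu1]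
        generalize j v = b at *
        fin_cases b <;> simp_all [k]
      linarith [hu1.2]
    by_cases hv1 : dist v x = 1 ∧ dist v y = 1
    · have hk1 : 2 ≤ k (i u) (j v) := by
        have hiu : i u ≠ 0 := fun h => huy ((hi0 u).1 h)
        rw [(hj1 v).2 hv1]
        generalize i u = b at *
        fin_cases b <;> simp_all [k]
      linarith [hv1.1, dist_comm v x]
    have hiu : i u = 2 := by simp only [i, if_neg huy, if_neg hu1]
    have hjv : j v = 2 := by simp only [j, if_neg hvx, if_neg hv1]
    have hk1 : k 2 2 = 3 := rfl
    rw [hiu, hjv, hk1]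
    linarith
  have hle : ∑ u ∈ S, ∑ v ∈ S, dist u v * γ u v ≤ ∑ u ∈ S, ∑ v ∈ S, k (i u) (j v) * γ u v := by
    refine Finset.sum_le_sum fun u _ => Finset.sum_le_sum fun v _ => ?_
    by_cases h : γ u v = 0
    · simp [h]
    · exact mul_le_mul_of_nonneg_right (hk u v (hγ0 u v h).1 (hγ0 u v h).2) (hγ u v)
  refine hle.trans (le_of_eq ?_)
  rw [hcost k, Finset.sum_add_distrib]
  have e : ∀ s t : ℝ, ∑ u ∈ S, f u - f y - g x - (s + t)
      = ∑ u ∈ S, f u - f y - s - g x - t := fun s t => by ring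
  rw [e, ← h1, ← h2, ← htot]
  simp [k, Fin.sum_univ_three]
  ring

/-- Main theorem: lower bound on the Ollivier–Ricci curvature `κ(x,y) = 1 - W₁(μx, μy)`
for local measures with laziness `α = μx x` removed and renormalized. -/
theorem main_orc_lower_bound {X : Type*} [MetricSpace X]
    (hint : ∀ u v : X, u ≠ v → ∃ n : ℕ, 0 < n ∧ dist u v = n)
    (x y : X) (hxy : dist x y = 1)
    (μx μy : X → ℝ) (hμx : IsFinProb μx) (hμy : IsFinProb μy)
    (hsx : ∀ z, μx z ≠ 0 → z = x ∨ dist z x = 1)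
    (hsy : ∀ z, μy z ≠ 0 → z = y ∨ dist z y = 1)
    (hle : μx x ≤ μy y) (hα : μx x < 1)
    (νx νy : X → ℝ)
    (hνx : νx = fun z => (μx z - (if z = x then μx x else 0)) / (1 - μx x))
    (hνy : νy = fun z => (μy z - (if z = y then μx x else 0)) / (1 - μx x)) :
    1 - W1 (fun u v => dist u v) μx μy ≥
      (1 - μx x) *
        (- max (1 - νx y - νy x -
              ∑ᶠ z, if dist z x = 1 ∧ dist z y = 1 then max (νx z) (νy z) else 0) 0
         - max (1 - νx y - νy x -
              ∑ᶠ z, if dist z x = 1 ∧ dist z y = 1 then min (νx z) (νy z) else 0) 0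
         + ∑ᶠ z, if dist z x = 1 ∧ dist z y = 1 then min (νx z) (νy z) else 0) := by
  have ha : 0 < 1 - μx x := sub_pos.2 hα
  obtain ⟨hx0, hxf, hx1⟩ := hμx
  obtain ⟨hy0, hyf, hy1⟩ := hμy
  set α := μx x with hαdef
  have hα0 : 0 ≤ α := hx0 x
  set S : Finset X := hxf.toFinset ∪ hyf.toFinset ∪ {x, y} with hSdef
  have hxS : x ∈ S := by simp [hSdef]
  have hyS : y ∈ S := by simp [hSdef]
  have hμxS : ∀ z, μx z ≠ 0 → z ∈ S := fun z hz => by simp [hSdef, hz]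
  have hμyS : ∀ z, μy z ≠ 0 → z ∈ S := fun z hz => by simp [hSdef, hz]
  have hμx_eq : ∀ z, μx z = (if z = x then α else 0) + (1 - α) * νx z := fun z => by
    simp only [hνx]; field_simp; ring
  have hμy_eq : ∀ z, μy z = (if z = y then α else 0) + (1 - α) * νy z := fun z => by
    simp only [hνy]; field_simp; ring
  have hνx0 : ∀ z, 0 ≤ νx z := fun z => by
    simp only [hνx]
    refine div_nonneg ?_ ha.le
    split_ifs with h
    · simp [h, hαdef]
    · simpa using hx0 z
  have hνy0 : ∀ z, 0 ≤ νy z := fun z => by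
    simp only [hνy]
    refine div_nonneg ?_ ha.le
    split_ifs with h
    · simpa [h] using hle
    · simpa using hy0 z
  have hνxd : ∀ z, νx z ≠ 0 → μx z ≠ 0 ∧ dist z x = 1 := fun z hz => by
    have hzx : z ≠ x := by
      rintro rfl
      simp [hνx, hαdef] at hz
    have h : μx z ≠ 0 := fun h => by simp [hνx, hzx, h] at hz
    exact ⟨h, (hsx z h).resolve_left hzx⟩
  have hνyS : ∀ z, νy z ≠ 0 → z ∈ S := fun z hz => by
    by_cases hzy : z = y
    · exact hzy ▸ hyS
    · exact hμyS z fun h => by simp [hνy, hzy, h] at hz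
  have hνyd : ∀ z, νy z ≠ 0 → z = y ∨ dist z y = 1 := fun z hz => by
    by_cases hzy : z = y
    · exact Or.inl hzy
    · exact hsy z fun h => by simp [hνy, hzy, h] at hz
  have hνxS : ∀ z, νx z ≠ 0 → z ∈ S := fun z hz => hμxS z (hνxd z hz).1
  have hνx1 : ∑ z ∈ S, νx z = 1 := by
    rw [finsum_eq_sum_of_support_subset _ (s := S) fun z hz => hμxS z hz,
      Finset.sum_congr rfl fun z _ => hμx_eq z, Finset.sum_add_distrib, ← Finset.mul_sum,
      Finset.sum_ite_eq' S x, if_pos hxS] at hx1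
    have : (1 - α) * (∑ z ∈ S, νx z - 1) = 0 := by linarith
    linarith [(mul_eq_zero.1 this).resolve_left ha.ne']
  have hνy1 : ∑ z ∈ S, νy z = 1 := by
    rw [finsum_eq_sum_of_support_subset _ (s := S) fun z hz => hμyS z hz,
      Finset.sum_congr rfl fun z _ => hμy_eq z, Finset.sum_add_distrib, ← Finset.mul_sum,
      Finset.sum_ite_eq' S y, if_pos hyS] at hy1
    have : (1 - α) * (∑ z ∈ S, νy z - 1) = 0 := by linarith
    linarith [(mul_eq_zero.1 this).resolve_left ha.ne']
  clear_value S
  set w : X → ℝ := fun z => if dist z x = 1 ∧ dist z y = 1 then min (νx z) (νy z) else 0 with hw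
  have hw0 : ∀ z, 0 ≤ w z := fun z => by
    simp only [hw]; split_ifs
    exacts [le_min (hνx0 z) (hνy0 z), le_rfl]
  have hwx : ∀ z, w z ≤ νx z := fun z => by
    simp only [hw]; split_ifs
    exacts [min_le_left _ _, hνx0 z]
  have hwy : ∀ z, w z ≤ νy z := fun z => by
    simp only [hw]; split_ifs
    exacts [min_le_right _ _, hνy0 z]
  have hfν : ∀ z, νx z - w z ≠ 0 → νx z ≠ 0 := fun z hz h =>
    hz (by linarith [hw0 z, hwx z])
  have hgν : ∀ z, νy z - w z ≠ 0 → νy z ≠ 0 := fun z hz h =>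
    hz (by linarith [hw0 z, hwy z])
  have hwS : ∀ z, w z ≠ 0 → z ∈ S := fun z hz => hνxS z fun h =>
    hz (by linarith [hw0 z, hwx z])
  have hwyy : w y = 0 := by simp [hw]
  have hwxx : w x = 0 := by simp [hw]
  obtain ⟨γ, hγ, hγS, hγf, hγg, hcost⟩ := exists_coupling_of_adjacent hxy S hxS hyS
    (fun z => νx z - w z) (fun z => νy z - w z)
    (fun z => sub_nonneg.2 (hwx z)) (fun z => sub_nonneg.2 (hwy z))
    (fun z hz => hνxS z (hfν z hz)) (fun z hz => hνyS z (hgν z hz))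
    (fun z hz => (hνxd z (hfν z hz)).2) (fun z hz => hνyd z (hgν z hz))
    (by simp only [Finset.sum_sub_distrib, hνx1, hνy1])
  have hmin : (∑ᶠ z, w z) = ∑ z ∈ S, w z :=
    finsum_eq_sum_of_support_subset _ fun z hz => hwS z hz
  have hmax : (∑ᶠ z, if dist z x = 1 ∧ dist z y = 1 then max (νx z) (νy z) else 0)
      = ∑ z ∈ S, if dist z x = 1 ∧ dist z y = 1 then max (νx z) (νy z) else 0 := by
    refine finsum_eq_sum_of_support_subset _ fun z hz => ?_
    by_contra hzS
    have h1 : νx z = 0 := by_contra fun h => hzS (hνxS z h)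
    have h2 : νy z = 0 := by_contra fun h => hzS (hνyS z h)
    simp [h1, h2] at hz
  have hsum : ∑ z ∈ S with dist z x = 1 ∧ dist z y = 1, (νx z - w z + (νy z - w z))
      = (∑ z ∈ S, if dist z x = 1 ∧ dist z y = 1 then max (νx z) (νy z) else 0)
        - ∑ z ∈ S, w z := by
    rw [Finset.sum_filter, ← Finset.sum_sub_distrib]
    refine Finset.sum_congr rfl fun z _ => ?_
    simp only [hw]
    split_ifs
    · linarith [max_add_min (νx z) (νy z)]
    · simp
  rw [hmin, hmax]
  simp only [hsum, Finset.sum_sub_distrib, hνx1, hwxx, hwyy, sub_zero] at hcost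
  set m := ∑ z ∈ S, w z
  set M := ∑ z ∈ S, if dist z x = 1 ∧ dist z y = 1 then max (νx z) (νy z) else 0
  rw [show 1 - m - νx y - νy x - (M - m) = 1 - νx y - νy x - M by ring,
    show 1 - m - νx y - νy x = 1 - νx y - νy x - m by ring] at hcost
  have hW := W1_le_of_coupling (d := fun u v : X => dist u v) (fun u v => dist_nonneg)
    (μ := μx) (ν := μy) S
    (fun u v => (if u = x then if v = y then α else 0 else 0)
      + (1 - α) * ((if u = v then w u else 0) + γ u v))
    (fun u v => by
      refine add_nonneg (by split_ifs <;> simp [hα0]) (mul_nonneg ha.le (add_nonneg ?_ (hγ u v)))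
      split_ifs
      exacts [hw0 u, le_rfl])
    (fun u v h => by
      by_contra hS
      have h1 : γ u v = 0 := by_contra fun h => hS (hγS u v h)
      have h2 : (if u = v then w u else 0) = 0 := by
        split_ifs with huv
        · by_contra h
          exact hS ⟨hwS u h, huv ▸ hwS u h⟩
        · rfl
      have h3 : (if u = x then if v = y then α else 0 else 0) = 0 := by
        split_ifs with hu hv
        · exact absurd ⟨hu ▸ hxS, hv ▸ hyS⟩ hS
        · rfl
        · rfl
      exact h (by simp only [h1, h2, h3, add_zero, mul_zero]))
    (fun u => by
      have h2 : ∑ v ∈ S, (if u = v then w u else 0) = w u := by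
        rw [Finset.sum_ite_eq, ite_eq_left_iff]
        exact fun h => (by_contra fun hne => h (hwS u (Ne.symm hne)))
      have h3 : ∑ v ∈ S, (if u = x then if v = y then α else 0 else 0)
          = if u = x then α else 0 := by
        split_ifs <;> simp [hyS]
      rw [Finset.sum_add_distrib, ← Finset.mul_sum, Finset.sum_add_distrib, hγf, h2, h3,
        hμx_eq]
      ring)
    (fun v => by
      have h2 : ∑ u ∈ S, (if u = v then w u else 0) = w v := by
        rw [Finset.sum_ite_eq', ite_eq_left_iff]
        exact fun h => (by_contra fun hne => h (hwS v (Ne.symm hne)))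
      have h3 : ∑ u ∈ S, (if u = x then if v = y then α else 0 else 0)
          = if v = y then α else 0 := by
        rw [Finset.sum_ite_eq', if_pos hxS]
      rw [Finset.sum_add_distrib, ← Finset.mul_sum, Finset.sum_add_distrib, hγg, h2, h3,
        hμy_eq]
      ring)
  have hval : ∑ u ∈ S, ∑ v ∈ S, dist u v * ((if u = x then if v = y then α else 0 else 0)
      + (1 - α) * ((if u = v then w u else 0) + γ u v))
      = α + (1 - α) * ∑ u ∈ S, ∑ v ∈ S, dist u v * γ u v := by
    have h3 : ∑ u ∈ S, ∑ v ∈ S, dist u v * (if u = x then if v = y then α else 0 else 0) = α := by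
      rw [Finset.sum_eq_single_of_mem x hxS fun u _ hu => by simp [hu],
        Finset.sum_eq_single_of_mem y hyS fun v _ hv => by simp [hv]]
      simp [hxy]
    have hsplit : ∀ u v, dist u v * ((if u = x then if v = y then α else 0 else 0)
        + (1 - α) * ((if u = v then w u else 0) + γ u v))
        = dist u v * (if u = x then if v = y then α else 0 else 0)
          + (1 - α) * (dist u v * γ u v) := fun u v => by
      have h2 : dist u v * (if u = v then w u else 0) = 0 := by
        split_ifs with h <;> simp [h]
      linear_combination (1 - α) * h2
    simp only [hsplit, Finset.sum_add_distrib, ← Finset.mul_sum, h3]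
  rw [hval] at hW
  have := mul_le_mul_of_nonneg_left hcost ha.le
  linarith
end

section
/- Let G = (V, E) be a connected locally finite simple graph with symmetric positive edge weights w, let d denote the graph distance, and for each vertex v let d_v = Σ_{u ∼ v} w_{vu} and μ_v(u) = w_{vu}/d_v for u ∼ v (and μ_v(u) = 0 otherwise). Then for any pair of adjacent vertices x, y: W₁(μ_x, μ_y) ≤ 1 + (1 − w_{xy}/d_x − w_{xy}/d_y − Σ_{x₁ : x₁ ∼ x, x₁ ∼ y} max(w_{x₁x}/d_x, w_{x₁y}/d_y))₊ + (1 − w_{xy}/d_x − w_{xy}/d_y − Σ_{x₁ : x₁ ∼ x, x₁ ∼ y} min(w_{x₁x}/d_x, w_{x₁y}/d_y))₊ − Σ_{x₁ : x₁ ∼ x, x₁ ∼ y} min(w_{x₁x}/d_x, w_{x₁y}/d_y). -/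
open scoped Classical

/-- A transport plan from `a` to `b` inside the finite set `S` whose cost is at most `c`. -/
def HasPlan {X : Type*} (S : Finset X) (d : X → X → ℝ) (a b : X → ℝ) (c : ℝ) : Prop :=
  ∃ γ : X → X → ℝ, (∀ u v, 0 ≤ γ u v) ∧ (∀ u v, γ u v ≠ 0 → u ∈ S ∧ v ∈ S) ∧
    (∀ u, ∑ v ∈ S, γ u v = a u) ∧ (∀ v, ∑ u ∈ S, γ u v = b v) ∧
    ∑ u ∈ S, ∑ v ∈ S, d u v * γ u v ≤ c

namespace HasPlan

variable {X : Type*} {S : Finset X} {d : X → X → ℝ}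

theorem zero : HasPlan S d 0 0 0 :=
  ⟨fun _ _ => 0, by simp, by simp, by simp, by simp, by simp⟩

theorem add {a b a' b' : X → ℝ} {c c' : ℝ} (h : HasPlan S d a b c) (h' : HasPlan S d a' b' c') :
    HasPlan S d (a + a') (b + b') (c + c') := by
  obtain ⟨γ, h0, hS, h1, h2, hc⟩ := h
  obtain ⟨γ', h0', hS', h1', h2', hc'⟩ := h'
  refine ⟨fun u v => γ u v + γ' u v, fun u v => add_nonneg (h0 u v) (h0' u v), fun u v huv => ?_,
    fun u => ?_, fun v => ?_, ?_⟩
  · by_cases hz : γ u v = 0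
    · exact hS' u v fun hz' => huv (by simp [hz, hz'])
    · exact hS u v hz
  · simp [Finset.sum_add_distrib, h1, h1']
  · simp [Finset.sum_add_distrib, h2, h2']
  · simpa only [mul_add, Finset.sum_add_distrib] using add_le_add hc hc'

theorem sum {ι : Type*} (s : Finset ι) {a b : ι → X → ℝ} {c : ι → ℝ}
    (h : ∀ i ∈ s, HasPlan S d (a i) (b i) (c i)) :
    HasPlan S d (∑ i ∈ s, a i) (∑ i ∈ s, b i) (∑ i ∈ s, c i) := by
  induction s using Finset.induction_on with
  | empty => simpa using zero
  | insert i s hi ih =>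
    rw [Finset.sum_insert hi, Finset.sum_insert hi, Finset.sum_insert hi]
    exact (h i (Finset.mem_insert_self i s)).add
      (ih fun j hj => h j (Finset.mem_insert_of_mem hj))

theorem diagonal {a : X → ℝ} (h0 : ∀ u, 0 ≤ a u) (hS : ∀ u, a u ≠ 0 → u ∈ S)
    (hd : ∀ u, d u u = 0) : HasPlan S d a a 0 := by
  refine ⟨fun u v => if u = v then a u else 0, fun u v => ?_, fun u v huv => ?_, fun u => ?_,
    fun v => ?_, ?_⟩
  · dsimp only
    split_ifs
    exacts [h0 u, le_rfl]
  · dsimp only at huv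
    split_ifs at huv with h
    · exact h ▸ ⟨hS u huv, hS u huv⟩
    · exact absurd rfl huv
  · rw [Finset.sum_ite_eq]
    split_ifs with h
    · rfl
    · exact (not_not.1 (mt (hS u) h)).symm
  · rw [Finset.sum_ite_eq']
    split_ifs with h
    · rfl
    · exact (not_not.1 (mt (hS v) h)).symm
  · refine (Finset.sum_eq_zero fun u _ => Finset.sum_eq_zero fun v _ => ?_).le
    dsimp only
    split_ifs with h
    · rw [← h, hd, zero_mul]
    · exact mul_zero _

/-- Moving an amount `m` from `a` to `b` proportionally, over distances at most `k`. -/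
theorem prod {a b : X → ℝ} {m k : ℝ} (ha : ∀ u, 0 ≤ a u) (hb : ∀ v, 0 ≤ b v)
    (haS : ∀ u, a u ≠ 0 → u ∈ S) (hbS : ∀ v, b v ≠ 0 → v ∈ S)
    (hm : 0 ≤ m) (hma : m ≤ ∑ u ∈ S, a u) (hmb : m ≤ ∑ v ∈ S, b v)
    (hd : ∀ u v, a u ≠ 0 → b v ≠ 0 → d u v ≤ k) :
    HasPlan S d (fun u => m / (∑ u ∈ S, a u) * a u) (fun v => m / (∑ v ∈ S, b v) * b v)
      (k * m) := by
  set A := ∑ u ∈ S, a u with hA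
  set B := ∑ v ∈ S, b v with hB
  rcases hm.eq_or_lt with rfl | hm
  · convert zero (S := S) (d := d) using 1
    · ext; simp
    · ext; simp
    · simp
  have hA0 : 0 < A := hm.trans_le hma
  have hB0 : 0 < B := hm.trans_le hmb
  have hnn : ∀ u v, 0 ≤ m / (A * B) * (a u * b v) := fun u v =>
    mul_nonneg (by positivity) (mul_nonneg (ha u) (hb v))
  refine ⟨fun u v => m / (A * B) * (a u * b v), hnn, fun u v huv => ?_, fun u => ?_,
    fun v => ?_, ?_⟩
  · have h := right_ne_zero_of_mul huv
    exact ⟨haS u (left_ne_zero_of_mul h), hbS v (right_ne_zero_of_mul h)⟩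
  · rw [← Finset.mul_sum, ← Finset.mul_sum, ← hB]
    field_simp
  · rw [← Finset.mul_sum, ← Finset.sum_mul, ← hA]
    field_simp
  · calc ∑ u ∈ S, ∑ v ∈ S, d u v * (m / (A * B) * (a u * b v))
        ≤ ∑ u ∈ S, ∑ v ∈ S, k * (m / (A * B) * (a u * b v)) := by
          refine Finset.sum_le_sum fun u _ => Finset.sum_le_sum fun v _ => ?_
          by_cases hu : a u = 0
          · simp [hu]
          by_cases hv : b v = 0
          · simp [hv]
          exact mul_le_mul_of_nonneg_right (hd u v hu hv) (hnn u v)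
      _ = k * m := by
          simp_rw [← Finset.mul_sum, ← hB, ← Finset.sum_mul, ← hA]
          field_simp

/-- Transport between two families of masses, following a prescribed matrix of amounts. -/
theorem of_matrix {ι κ : Type*} [Fintype ι] [Fintype κ] {a : ι → X → ℝ} {b : κ → X → ℝ}
    {m k : ι → κ → ℝ} (ha : ∀ i u, 0 ≤ a i u) (hb : ∀ j v, 0 ≤ b j v)
    (haS : ∀ i u, a i u ≠ 0 → u ∈ S) (hbS : ∀ j v, b j v ≠ 0 → v ∈ S)
    (hm : ∀ i j, 0 ≤ m i j) (hma : ∀ i, ∑ j, m i j = ∑ u ∈ S, a i u)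
    (hmb : ∀ j, ∑ i, m i j = ∑ v ∈ S, b j v)
    (hd : ∀ i j u v, a i u ≠ 0 → b j v ≠ 0 → d u v ≤ k i j) :
    HasPlan S d (∑ i, a i) (∑ j, b j) (∑ i, ∑ j, k i j * m i j) := by
  have key : ∀ f : X → ℝ, (∀ u, 0 ≤ f u) → (∀ u, f u ≠ 0 → u ∈ S) → ∀ u,
      (∑ u ∈ S, f u) / (∑ u ∈ S, f u) * f u = f u := by
    intro f h0 hS u
    by_cases h : ∑ u ∈ S, f u = 0
    · have : f u = 0 := by
        by_contra hu
        exact hu ((Finset.sum_eq_zero_iff_of_nonneg fun v _ => h0 v).1 h u (hS u hu))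
      simp [this]
    · rw [div_self h, one_mul]
  have h := sum Finset.univ fun i _ => sum Finset.univ fun j _ =>
    prod (ha i) (hb j) (haS i) (hbS j) (hm i j)
      ((Finset.single_le_sum (fun j _ => hm i j) (Finset.mem_univ j)).trans (hma i).le)
      ((Finset.single_le_sum (f := fun i => m i j) (fun i _ => hm i j)
        (Finset.mem_univ i)).trans (hmb j).le) (hd i j)
  convert h using 1
  · refine Finset.sum_congr rfl fun i _ => ?_
    ext u
    rw [Finset.sum_apply, ← Finset.sum_mul, ← Finset.sum_div, hma, key _ (ha i) (haS i)]
  · rw [Finset.sum_comm]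
    refine Finset.sum_congr rfl fun j _ => ?_
    ext v
    rw [Finset.sum_apply, ← Finset.sum_mul, ← Finset.sum_div, hmb, key _ (hb j) (hbS j)]

theorem W1_le {a b : X → ℝ} {c : ℝ} (hd : ∀ u v, 0 ≤ d u v) (h : HasPlan S d a b c) :
    W1 d a b ≤ c := by
  obtain ⟨γ, h0, hS, h1, h2, hc⟩ := h
  refine le_trans (csInf_le ⟨0, ?_⟩ ⟨Finsupp.onFinset (S ×ˢ S) (fun p => γ p.1 p.2)
    fun p hp => Finset.mem_product.2 (hS _ _ hp), fun p => h0 _ _, fun u => ?_, fun v => ?_,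
    rfl⟩) ?_
  · rintro _ ⟨δ, hδ, -, -, rfl⟩
    exact finsum_nonneg fun p => mul_nonneg (hd _ _) (hδ p)
  · rw [← h1 u]
    exact finsum_eq_sum_of_support_subset _ fun v hv => (hS u v hv).2
  · rw [← h2 v]
    exact finsum_eq_sum_of_support_subset _ fun u hu => (hS u v hu).1
  · rw [finsum_eq_sum_of_support_subset (s := S ×ˢ S), Finset.sum_product]
    · exact hc
    · intro p hp
      exact Finset.mem_coe.2 (Finset.mem_product.2 (hS _ _ (right_ne_zero_of_mul hp)))

end HasPlan

/-- Transport from three sources of masses `A`, `E`, `p` to three sinks of masses `B`, `F`, `q`. -/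
theorem exists_transport_matrix {A B E F p q : ℝ} (hA : 0 ≤ A) (hB : 0 ≤ B) (hE : 0 ≤ E)
    (hF : 0 ≤ F) (hp : 0 ≤ p) (hq : 0 ≤ q) (h : A + E + p = B + F + q) :
    ∃ m : Fin 3 → Fin 3 → ℝ, (∀ i j, 0 ≤ m i j) ∧ (∀ i, ∑ j, m i j = ![A, E, p] i) ∧
      (∀ j, ∑ i, m i j = ![B, F, q] j) ∧
      ∑ i, ∑ j, (![![3, 2, 1], ![2, 2, 1], ![1, 1, 1]] : Fin 3 → Fin 3 → ℝ) i j * m i j ≤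
        A + E + p + max (A - q - F) 0 + max (A + E - q) 0 := by
  have of_entries : ∀ a b c a' b' c' a'' b'' c'' : ℝ, 0 ≤ a → 0 ≤ b → 0 ≤ c → 0 ≤ a' → 0 ≤ b' →
      0 ≤ c' → 0 ≤ a'' → 0 ≤ b'' → 0 ≤ c'' → a + b + c = A → a' + b' + c' = E →
      a'' + b'' + c'' = p → a + a' + a'' = B → b + b' + b'' = F → c + c' + c'' = q →
      2 * a + b + a' + b' ≤ max (A - q - F) 0 + max (A + E - q) 0 →
      ∃ m : Fin 3 → Fin 3 → ℝ, (∀ i j, 0 ≤ m i j) ∧ (∀ i, ∑ j, m i j = ![A, E, p] i) ∧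
      (∀ j, ∑ i, m i j = ![B, F, q] j) ∧
      ∑ i, ∑ j, (![![3, 2, 1], ![2, 2, 1], ![1, 1, 1]] : Fin 3 → Fin 3 → ℝ) i j * m i j ≤
        A + E + p + max (A - q - F) 0 + max (A + E - q) 0 := by
    intro a b c a' b' c' a'' b'' c''
    intros
    refine ⟨![![a, b, c], ![a', b', c'], ![a'', b'', c'']], ?_, ?_, ?_, ?_⟩
    · intro i j
      fin_cases i <;> fin_cases j <;> simpa
    · intro i
      fin_cases i <;> simpa [Fin.sum_univ_three]
    · intro j
      fin_cases j <;> simpa [Fin.sum_univ_three]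
    · simp [Fin.sum_univ_three]
      linarith
  rcases le_total 0 (A - q - F) with h1 | h1
  · refine of_entries (A - q - F) F q E 0 0 p 0 0 ?_ ?_ ?_ ?_ ?_ ?_ ?_ ?_ ?_ ?_ ?_ ?_ ?_ ?_ ?_ ?_ <;>
      linarith [le_max_left (A - q - F) 0, le_max_left (A + E - q) 0]
  rcases le_total 0 (A + E - q) with h2 | h2
  · have hs : min A q = A ∨ min A q = q := min_choice A q
    have ht : min B p = B ∨ min B p = p := min_choice B p
    have := min_le_left A q
    have := min_le_right A q
    have := min_le_left B p
    have := min_le_right B p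
    have := le_min hA hq
    have := le_min hB hp
    generalize min A q = s at *
    generalize min B p = t at *
    refine of_entries 0 (A - s) s (B - t) (E - q + s - B + t) (q - s) t (p - t) 0
      ?_ ?_ ?_ ?_ ?_ ?_ ?_ ?_ ?_ ?_ ?_ ?_ ?_ ?_ ?_ ?_ <;>
    first
    | linarith [le_max_right (A - q - F) 0, le_max_left (A + E - q) 0]
    | rcases hs with rfl | rfl <;> rcases ht with rfl | rfl <;> linarith
  · refine of_entries 0 0 A 0 0 E B F (q - A - E) ?_ ?_ ?_ ?_ ?_ ?_ ?_ ?_ ?_ ?_ ?_ ?_ ?_ ?_ ?_ ?_ <;>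
      linarith [le_max_right (A - q - F) 0, le_max_right (A + E - q) 0]

/-- Upper bound on the Wasserstein distance between the local random-walk measures
at adjacent vertices of a weighted, connected, locally finite simple graph. -/
theorem graph_wasserstein_upper_bound {V : Type*} (G : SimpleGraph V) [G.LocallyFinite]
    (hconn : G.Connected)
    (w : V → V → ℝ) (hsymm : ∀ u v, w u v = w v u)
    (hpos : ∀ u v, G.Adj u v → 0 < w u v)
    (D : V → ℝ) (hD : ∀ v, D v = ∑ u ∈ G.neighborFinset v, w v u)
    (μ : V → V → ℝ) (hμ : ∀ v u, μ v u = if G.Adj v u then w v u / D v else 0)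
    (x y : V) (hxy : G.Adj x y) :
    W1 (fun u v => (G.dist u v : ℝ)) (μ x) (μ y) ≤
      1 + max (1 - w x y / D x - w x y / D y -
            ∑ᶠ z, if G.Adj z x ∧ G.Adj z y then max (w z x / D x) (w z y / D y) else 0) 0
        + max (1 - w x y / D x - w x y / D y -
            ∑ᶠ z, if G.Adj z x ∧ G.Adj z y then min (w z x / D x) (w z y / D y) else 0) 0
        - ∑ᶠ z, if G.Adj z x ∧ G.Adj z y then min (w z x / D x) (w z y / D y) else 0 := by
  have hDpos : ∀ {u v}, G.Adj u v → 0 < D u := by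
    intro u v huv
    rw [hD]
    exact Finset.sum_pos (fun z hz => hpos _ _ ((G.mem_neighborFinset u z).1 hz))
      ⟨v, (G.mem_neighborFinset u v).2 huv⟩
  have hμ0 : ∀ u v, 0 ≤ μ u v := by
    intro u v
    rw [hμ]
    split_ifs with h
    exacts [(div_pos (hpos _ _ h) (hDpos h)).le, le_rfl]
  have hμadj : ∀ {u v}, μ u v ≠ 0 → G.Adj u v := by
    intro u v h
    by_contra h'
    exact h (by rw [hμ, if_neg h'])
  set S := G.neighborFinset x ∪ G.neighborFinset y
  have hSx : ∀ {u}, G.Adj x u → u ∈ S := fun h =>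
    Finset.mem_union_left _ ((G.mem_neighborFinset _ _).2 h)
  have hSy : ∀ {u}, G.Adj y u → u ∈ S := fun h =>
    Finset.mem_union_right _ ((G.mem_neighborFinset _ _).2 h)
  have hmass : ∀ {u v}, G.Adj u v → G.neighborFinset u ⊆ S → ∑ z ∈ S, μ u z = 1 := by
    intro u v huv hsub
    rw [← Finset.sum_subset hsub fun z _ hz => by
      rw [hμ, if_neg (mt (G.mem_neighborFinset u z).2 hz)]]
    rw [Finset.sum_congr rfl fun z hz => by
      rw [hμ, if_pos ((G.mem_neighborFinset u z).1 hz)], ← Finset.sum_div, ← hD,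
      div_self (hDpos huv).ne']
  have hmx := hmass hxy Finset.subset_union_left
  have hmy := hmass hxy.symm Finset.subset_union_right
  set c : V → ℝ := fun u => if G.Adj x u ∧ G.Adj y u then min (μ x u) (μ y u) else 0 with hc
  set e : V → ℝ := fun u => if G.Adj x u ∧ G.Adj y u then μ x u - min (μ x u) (μ y u) else 0
    with he
  set f : V → ℝ := fun u => if G.Adj x u ∧ G.Adj y u then μ y u - min (μ x u) (μ y u) else 0
    with hf
  set na : V → ℝ := fun u => if G.Adj x u ∧ ¬ G.Adj y u ∧ u ≠ y then μ x u else 0 with hna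
  set nb : V → ℝ := fun u => if G.Adj y u ∧ ¬ G.Adj x u ∧ u ≠ x then μ y u else 0 with hnb
  set ya : V → ℝ := fun u => if u = y then μ x u else 0 with hya
  set xb : V → ℝ := fun u => if u = x then μ y u else 0 with hxb
  have hax : ∀ u, μ x u = c u + (na u + e u + ya u) := by
    intro u
    by_cases h3 : u = y
    · simp [hc, hna, he, hya, h3]
    by_cases h1 : G.Adj x u
    · by_cases h2 : G.Adj y u <;> simp [hc, hna, he, hya, h1, h2, h3]
    · simp [hc, hna, he, hya, h1, h3, not_not.1 (mt hμadj h1)]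
  have hby : ∀ u, μ y u = c u + (nb u + f u + xb u) := by
    intro u
    by_cases h3 : u = x
    · simp [hc, hnb, hf, hxb, h3]
    by_cases h1 : G.Adj y u
    · by_cases h2 : G.Adj x u <;> simp [hc, hnb, hf, hxb, h1, h2, h3]
    · simp [hc, hnb, hf, hxb, h1, h3, not_not.1 (mt hμadj h1)]
  have hmin : (∑ᶠ z, if G.Adj z x ∧ G.Adj z y then min (w z x / D x) (w z y / D y) else 0)
      = ∑ z ∈ S, c z := by
    rw [← finsum_eq_sum_of_support_subset (s := S) c fun u hu => ?_]
    · refine finsum_congr fun z => ?_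
      simp only [hc, G.adj_comm z, hsymm z]
      split_ifs with h
      · rw [hμ, hμ, if_pos h.1, if_pos h.2]
      · rfl
    · by_contra h
      exact hu (if_neg fun h' => h (hSx h'.1))
  have hmax : (∑ᶠ z, if G.Adj z x ∧ G.Adj z y then max (w z x / D x) (w z y / D y) else 0)
      = ∑ z ∈ S, (c z + e z + f z) := by
    rw [← finsum_eq_sum_of_support_subset (s := S) (fun z => c z + e z + f z) fun u hu => ?_]
    · refine finsum_congr fun z => ?_
      simp only [hc, he, hf, G.adj_comm z, hsymm z]
      split_ifs with h
      · rw [hμ x, hμ y, if_pos h.1, if_pos h.2]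
        linarith [min_add_max (w x z / D x) (w y z / D y)]
      · simp
    · by_contra h
      exact hu (by
        have : ¬ (G.Adj x u ∧ G.Adj y u) := fun h' => h (hSx h'.1)
        simp [hc, he, hf, this])
  have hya_sum : ∑ z ∈ S, ya z = w x y / D x := by
    rw [hya, Finset.sum_ite_eq', if_pos (hSx hxy), hμ, if_pos hxy]
  have hxb_sum : ∑ z ∈ S, xb z = w x y / D y := by
    rw [hxb, Finset.sum_ite_eq', if_pos (hSy hxy.symm), hμ, if_pos hxy.symm, hsymm]
  have hc0 : ∀ u, 0 ≤ c u := fun u => by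
    simp only [hc]; split_ifs
    exacts [le_min (hμ0 _ _) (hμ0 _ _), le_rfl]
  have he0 : ∀ u, 0 ≤ e u := fun u => by
    simp only [he]; split_ifs
    exacts [sub_nonneg.2 (min_le_left _ _), le_rfl]
  have hf0 : ∀ u, 0 ≤ f u := fun u => by
    simp only [hf]; split_ifs
    exacts [sub_nonneg.2 (min_le_right _ _), le_rfl]
  have hna0 : ∀ u, 0 ≤ na u := fun u => by
    simp only [hna]; split_ifs
    exacts [hμ0 _ _, le_rfl]
  have hnb0 : ∀ u, 0 ≤ nb u := fun u => by
    simp only [hnb]; split_ifs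
    exacts [hμ0 _ _, le_rfl]
  have hya0 : ∀ u, 0 ≤ ya u := fun u => by
    simp only [hya]; split_ifs
    exacts [hμ0 _ _, le_rfl]
  have hxb0 : ∀ u, 0 ≤ xb u := fun u => by
    simp only [hxb]; split_ifs
    exacts [hμ0 _ _, le_rfl]
  have hcadj : ∀ {u}, c u ≠ 0 → G.Adj x u ∧ G.Adj y u := fun h => by
    by_contra h'; exact h (if_neg h')
  have headj : ∀ {u}, e u ≠ 0 → G.Adj x u ∧ G.Adj y u := fun h => by
    by_contra h'; exact h (if_neg h')
  have hfadj : ∀ {u}, f u ≠ 0 → G.Adj x u ∧ G.Adj y u := fun h => by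
    by_contra h'; exact h (if_neg h')
  have hnaadj : ∀ {u}, na u ≠ 0 → G.Adj x u := fun h => by
    by_contra h'; exact h (if_neg fun h'' => h' h''.1)
  have hnbadj : ∀ {u}, nb u ≠ 0 → G.Adj y u := fun h => by
    by_contra h'; exact h (if_neg fun h'' => h' h''.1)
  have hyaeq : ∀ {u}, ya u ≠ 0 → u = y := fun h => by
    by_contra h'; exact h (if_neg h')
  have hxbeq : ∀ {u}, xb u ≠ 0 → u = x := fun h => by
    by_contra h'; exact h (if_neg h')
  have hd1 : ∀ {u v}, G.Adj u v → (G.dist u v : ℝ) ≤ 1 := fun h => by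
    rw [SimpleGraph.dist_eq_one_iff_adj.2 h]; norm_num
  have hd2 : ∀ {u v} z, G.Adj z u → G.Adj z v → (G.dist u v : ℝ) ≤ 2 := fun z h h' => by
    exact_mod_cast SimpleGraph.dist_le (.cons h.symm (.cons h' .nil))
  have hd3 : ∀ {u v}, G.Adj x u → G.Adj y v → (G.dist u v : ℝ) ≤ 3 := fun h h' => by
    exact_mod_cast SimpleGraph.dist_le (.cons h.symm (.cons hxy (.cons h' .nil)))
  rw [Finset.sum_congr rfl fun u _ => hax u] at hmx
  rw [Finset.sum_congr rfl fun u _ => hby u] at hmy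
  simp only [Finset.sum_add_distrib] at hmx hmy hmax
  obtain ⟨m, hm0, hm1, hm2, hcost⟩ := exists_transport_matrix
    (Finset.sum_nonneg fun u (_ : u ∈ S) => hna0 u) (Finset.sum_nonneg fun u (_ : u ∈ S) => hnb0 u)
    (Finset.sum_nonneg fun u (_ : u ∈ S) => he0 u) (Finset.sum_nonneg fun u (_ : u ∈ S) => hf0 u)
    (Finset.sum_nonneg fun u (_ : u ∈ S) => hya0 u) (Finset.sum_nonneg fun u (_ : u ∈ S) => hxb0 u)
    (by linarith)
  have hplan := HasPlan.of_matrix (S := S) (d := fun u v => (G.dist u v : ℝ))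
    (a := ![na, e, ya]) (b := ![nb, f, xb]) (m := m)
    (k := ![![3, 2, 1], ![2, 2, 1], ![1, 1, 1]])
    (by intro i; fin_cases i; exacts [hna0, he0, hya0])
    (by intro j; fin_cases j; exacts [hnb0, hf0, hxb0])
    (by
      intro i; fin_cases i
      exacts [fun u h => hSx (hnaadj h), fun u h => hSx (headj h).1,
        fun u h => hyaeq h ▸ hSx hxy])
    (by
      intro j; fin_cases j
      exacts [fun u h => hSy (hnbadj h), fun u h => hSx (hfadj h).1,
        fun u h => hxbeq h ▸ hSy hxy.symm])
    hm0
    (by intro i; rw [hm1]; fin_cases i <;> rfl)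
    (by intro j; rw [hm2]; fin_cases j <;> rfl)
    (by
      intro i j u v; fin_cases i <;> fin_cases j
      · exact fun hu hv => hd3 (hnaadj hu) (hnbadj hv)
      · exact fun hu hv => hd2 x (hnaadj hu) (hfadj hv).1
      · exact fun hu hv => hxbeq hv ▸ hd1 (hnaadj hu).symm
      · exact fun hu hv => hd2 y (headj hu).2 (hnbadj hv)
      · exact fun hu hv => hd2 x (headj hu).1 (hfadj hv).1
      · exact fun hu hv => hxbeq hv ▸ hd1 (headj hu).1.symm
      · exact fun hu hv => hyaeq hu ▸ hd1 (hnbadj hv)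
      · exact fun hu hv => hyaeq hu ▸ hd1 (hfadj hv).2
      · exact fun hu hv => hyaeq hu ▸ hxbeq hv ▸ hd1 hxy.symm)
  have htotal := (HasPlan.diagonal (d := fun u v => (G.dist u v : ℝ)) hc0
    (fun u h => hSx (hcadj h).1) (by simp)).add hplan
  have hx_eq : μ x = c + ∑ i, ![na, e, ya] i := by
    ext u; simp [Fin.sum_univ_three, hax u]
  have hy_eq : μ y = c + ∑ i, ![nb, f, xb] i := by
    ext u; simp [Fin.sum_univ_three, hby u]
  rw [← hx_eq, ← hy_eq] at htotal
  refine (htotal.W1_le fun u v => Nat.cast_nonneg _).trans ?_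
  rw [hmin, hmax, ← hya_sum, ← hxb_sum, zero_add]
  refine hcost.trans (le_of_eq ?_)
  rw [show 1 - ∑ z ∈ S, ya z - ∑ z ∈ S, xb z - (∑ z ∈ S, c z + ∑ z ∈ S, e z + ∑ z ∈ S, f z)
      = ∑ z ∈ S, na z - ∑ z ∈ S, xb z - ∑ z ∈ S, f z by linarith,
    show 1 - ∑ z ∈ S, ya z - ∑ z ∈ S, xb z - ∑ z ∈ S, c z
      = ∑ z ∈ S, na z + ∑ z ∈ S, e z - ∑ z ∈ S, xb z by linarith]
  linarith
end

section
/- Let G = (V, E) be a connected locally finite simple graph with symmetric positive edge weights w, let d denote the graph distance, and for each vertex v let d_v = Σ_{u ∼ v} w_{vu} and μ_v(u) = w_{vu}/d_v for u ∼ v (and μ_v(u) = 0 otherwise). For α ∈ (0, 1), let μ_v^α = α δ_v + (1 − α) μ_v and κ^α(x, y) = 1 − W₁(μ_x^α, μ_y^α). Then for any pair of adjacent vertices x, y: κ^α(x, y) ≥ (1 − α) · [− (1 − w_{xy}/d_x − w_{xy}/d_y − Σ_{x₁ : x₁ ∼ x, x₁ ∼ y} max(w_{x₁x}/d_x, w_{x₁y}/d_y))₊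 − (1 − w_{xy}/d_x − w_{xy}/d_y − Σ_{x₁ : x₁ ∼ x, x₁ ∼ y} min(w_{x₁x}/d_x, w_{x₁y}/d_y))₊ + Σ_{x₁ : x₁ ∼ x, x₁ ∼ y} min(w_{x₁x}/d_x, w_{x₁y}/d_y)]. -/
open scoped Classical

/-- `HasPlanOn S d μ ν c` says that some transport plan from `μ` to `ν`, supported on `S × S`,
has total cost at most `c`. -/
def HasPlanOn {X : Type*} (S : Finset X) (d : X → X → ℝ) (μ ν : X → ℝ) (c : ℝ) : Prop :=
  ∃ γ : X → X → ℝ, (∀ u v, 0 ≤ γ u v) ∧ (∀ u v, γ u v ≠ 0 → u ∈ S ∧ v ∈ S) ∧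
    (∀ u, ∑ v ∈ S, γ u v = μ u) ∧ (∀ v, ∑ u ∈ S, γ u v = ν v) ∧
    ∑ u ∈ S, ∑ v ∈ S, d u v * γ u v ≤ c

namespace HasPlanOn

variable {X : Type*} {S : Finset X} {d : X → X → ℝ}

theorem zero : HasPlanOn S d 0 0 0 :=
  ⟨fun _ _ => 0, by simp, by simp, by simp, by simp, by simp⟩

theorem add {μ ν μ' ν' : X → ℝ} {c c' : ℝ} (h : HasPlanOn S d μ ν c)
    (h' : HasPlanOn S d μ' ν' c') : HasPlanOn S d (μ + μ') (ν + ν') (c + c') := by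
  obtain ⟨γ, h0, hS, h1, h2, hc⟩ := h
  obtain ⟨γ', h0', hS', h1', h2', hc'⟩ := h'
  refine ⟨fun u v => γ u v + γ' u v, fun u v => add_nonneg (h0 u v) (h0' u v), ?_, ?_, ?_, ?_⟩
  · intro u v huv
    by_cases h : γ u v = 0
    · exact hS' u v fun h'' => huv (by simp [h, h''])
    · exact hS u v h
  · intro u
    simp [Finset.sum_add_distrib, h1, h1']
  · intro v
    simp [Finset.sum_add_distrib, h2, h2']
  · simp only [mul_add, Finset.sum_add_distrib]
    exact add_le_add hc hc'

theorem sum {ι : Type*} (s : Finset ι) {μ ν : ι → X → ℝ} {c : ι → ℝ}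
    (h : ∀ i ∈ s, HasPlanOn S d (μ i) (ν i) (c i)) :
    HasPlanOn S d (∑ i ∈ s, μ i) (∑ i ∈ s, ν i) (∑ i ∈ s, c i) := by
  induction s using Finset.induction_on with
  | empty => simpa using zero
  | insert i s hi ih =>
    simp only [Finset.sum_insert hi]
    exact (h i (by simp)).add (ih fun j hj => h j (by simp [hj]))

theorem smul {μ ν : X → ℝ} {c r : ℝ} (hr : 0 ≤ r) (h : HasPlanOn S d μ ν c) :
    HasPlanOn S d (r • μ) (r • ν) (r * c) := by
  obtain ⟨γ, h0, hS, h1, h2, hc⟩ := h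
  refine ⟨fun u v => r * γ u v, fun u v => mul_nonneg hr (h0 u v),
    fun u v huv => hS u v (right_ne_zero_of_mul huv), ?_, ?_, ?_⟩
  · intro u
    simp [← Finset.mul_sum, h1]
  · intro v
    simp [← Finset.mul_sum, h2]
  · simp only [mul_left_comm _ r, ← Finset.mul_sum]
    exact mul_le_mul_of_nonneg_left hc hr

theorem refl {μ : X → ℝ} (hμ : ∀ u, 0 ≤ μ u) (hS : ∀ u, μ u ≠ 0 → u ∈ S)
    (hd : ∀ u, d u u = 0) : HasPlanOn S d μ μ 0 := by
  refine ⟨fun u v => if u = v then μ u else 0, ?_, ?_, ?_, ?_, ?_⟩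
  · intro u v
    dsimp only
    split_ifs
    exacts [hμ u, le_rfl]
  · intro u v h
    by_cases huv : u = v
    · subst huv
      have := hS u (by simpa using h)
      exact ⟨this, this⟩
    · simp [huv] at h
  · intro u
    simp only [Finset.sum_ite_eq, ite_eq_left_iff]
    exact fun h => (not_not.1 (mt (hS u) h)).symm
  · intro v
    simp only [Finset.sum_ite_eq', ite_eq_left_iff]
    exact fun h => (not_not.1 (mt (hS v) h)).symm
  · refine (Finset.sum_eq_zero fun u _ => Finset.sum_eq_zero fun v _ => ?_).le
    by_cases h : u = v <;> simp [h, hd]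

theorem prod {σ τ : X → ℝ} {s t n k : ℝ} (hσ : ∀ u, 0 ≤ σ u) (hτ : ∀ u, 0 ≤ τ u)
    (hσS : ∀ u, σ u ≠ 0 → u ∈ S) (hτS : ∀ u, τ u ≠ 0 → u ∈ S)
    (hs : ∑ u ∈ S, σ u = s) (ht : ∑ u ∈ S, τ u = t) (hn : 0 ≤ n)
    (hsn : s = 0 → n = 0) (htn : t = 0 → n = 0)
    (hd : ∀ u v, σ u ≠ 0 → τ v ≠ 0 → d u v ≤ k) :
    HasPlanOn S d ((n / s) • σ) ((n / t) • τ) (k * n) := by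
  by_cases hn0 : n = 0
  · simpa [hn0] using zero
  have hs0 : s ≠ 0 := fun h => hn0 (hsn h)
  have ht0 : t ≠ 0 := fun h => hn0 (htn h)
  have hr : 0 ≤ n / (s * t) := div_nonneg hn (mul_nonneg
    (hs ▸ Finset.sum_nonneg fun u _ => hσ u) (ht ▸ Finset.sum_nonneg fun u _ => hτ u))
  refine ⟨fun u v => n / (s * t) * (σ u * τ v),
    fun u v => mul_nonneg hr (mul_nonneg (hσ u) (hτ v)), ?_, ?_, ?_, ?_⟩
  · intro u v h
    have h' := right_ne_zero_of_mul h
    exact ⟨hσS u (left_ne_zero_of_mul h'), hτS v (right_ne_zero_of_mul h')⟩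
  · intro u
    simp only [← Finset.mul_sum, ht, Pi.smul_apply, smul_eq_mul]
    field_simp
  · intro v
    simp only [← Finset.mul_sum, ← Finset.sum_mul, hs, Pi.smul_apply, smul_eq_mul]
    field_simp
  · calc ∑ u ∈ S, ∑ v ∈ S, d u v * (n / (s * t) * (σ u * τ v))
        ≤ ∑ u ∈ S, ∑ v ∈ S, k * (n / (s * t) * (σ u * τ v)) := by
          refine Finset.sum_le_sum fun u _ => Finset.sum_le_sum fun v _ => ?_
          by_cases h : σ u * τ v = 0
          · simp [h]
          · exact mul_le_mul_of_nonneg_right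
              (hd u v (left_ne_zero_of_mul h) (right_ne_zero_of_mul h))
              (mul_nonneg hr (mul_nonneg (hσ u) (hτ v)))
      _ = k * n := by
          simp only [← Finset.mul_sum, ← Finset.sum_mul, hs, ht]
          field_simp

/-- Plans between pieces of two measures: `n i j` is the mass sent from the piece `σ i` to the
piece `τ j`. -/
theorem of_blocks {ι κ : Type*} [Fintype ι] [Fintype κ] {σ : ι → X → ℝ} {τ : κ → X → ℝ}
    {n k : ι → κ → ℝ} (hσ : ∀ i u, 0 ≤ σ i u) (hτ : ∀ j u, 0 ≤ τ j u)
    (hσS : ∀ i u, σ i u ≠ 0 → u ∈ S) (hτS : ∀ j u, τ j u ≠ 0 → u ∈ S)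
    (hn : ∀ i j, 0 ≤ n i j) (hrow : ∀ i, ∑ j, n i j = ∑ u ∈ S, σ i u)
    (hcol : ∀ j, ∑ i, n i j = ∑ u ∈ S, τ j u)
    (hd : ∀ i j u v, σ i u ≠ 0 → τ j v ≠ 0 → d u v ≤ k i j) :
    HasPlanOn S d (∑ i, σ i) (∑ j, τ j) (∑ i, ∑ j, k i j * n i j) := by
  have key {ρ : X → ℝ} (hρ : ∀ u, 0 ≤ ρ u) (hρS : ∀ u, ρ u ≠ 0 → u ∈ S) :
      ((∑ u ∈ S, ρ u) / ∑ u ∈ S, ρ u) • ρ = ρ := by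
    by_cases h : ∑ u ∈ S, ρ u = 0
    · ext u
      have : ρ u = 0 := by
        by_contra hu
        exact hu ((Finset.sum_eq_zero_iff_of_nonneg fun u _ => hρ u).1 h u (hρS u hu))
      simp [this]
    · rw [div_self h, one_smul]
  have h1 : ∑ i, ∑ j, (n i j / ∑ u ∈ S, σ i u) • σ i = ∑ i, σ i :=
    Finset.sum_congr rfl fun i _ => by
      rw [← Finset.sum_smul, ← Finset.sum_div, hrow, key (hσ i) (hσS i)]
  have h2 : ∑ i, ∑ j, (n i j / ∑ u ∈ S, τ j u) • τ j = ∑ j, τ j := by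
    rw [Finset.sum_comm]
    refine Finset.sum_congr rfl fun j _ => ?_
    rw [← Finset.sum_smul, ← Finset.sum_div, hcol, key (hτ j) (hτS j)]
  rw [← h1, ← h2]
  refine sum _ fun i _ => sum _ fun j _ =>
    prod (hσ i) (hτ j) (hσS i) (hτS j) rfl rfl (hn i j) ?_ ?_ (hd i j)
  · intro h
    rw [← hrow] at h
    exact (Finset.sum_eq_zero_iff_of_nonneg fun j _ => hn i j).1 h j (Finset.mem_univ j)
  · intro h
    rw [← hcol] at h
    exact (Finset.sum_eq_zero_iff_of_nonneg fun i _ => hn i j).1 h i (Finset.mem_univ i)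

theorem W1_le {μ ν : X → ℝ} {c : ℝ} (hd : ∀ u v, 0 ≤ d u v) (h : HasPlanOn S d μ ν c) :
    W1 d μ ν ≤ c := by
  obtain ⟨γ, h0, hS, h1, h2, hc⟩ := h
  refine le_trans (csInf_le ⟨0, ?_⟩ ?_) hc
  · rintro _ ⟨γ', h0', -, -, rfl⟩
    exact finsum_nonneg fun p => mul_nonneg (hd _ _) (h0' p)
  · refine ⟨Finsupp.onFinset (S ×ˢ S) (fun p => γ p.1 p.2)
      fun p hp => Finset.mem_product.2 (hS _ _ hp), fun p => h0 _ _, ?_, ?_, ?_⟩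
    · intro u
      rw [← h1 u]
      exact finsum_eq_sum_of_support_subset _ fun v hv => (hS _ _ hv).2
    · intro v
      rw [← h2 v]
      exact finsum_eq_sum_of_support_subset _ fun u hu => (hS _ _ hu).1
    · rw [← Finset.sum_product' S S fun u v => d u v * γ u v]
      refine (finsum_eq_sum_of_support_subset _ fun p hp => ?_).symm
      exact Finset.mem_coe.2 (Finset.mem_product.2 (hS _ _ (right_ne_zero_of_mul hp)))

end HasPlanOn

/-- An explicit solution of the `3 × 3` transport problem with masses `p, e, a` and `q, f, b` and
costs `1, 1, 1; 1, 2, 2; 1, 2, 3`. -/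
theorem exists_three_block_plan {p e a q f b : ℝ} (hp : 0 ≤ p) (he : 0 ≤ e) (ha : 0 ≤ a)
    (hq : 0 ≤ q) (hf : 0 ≤ f) (hb : 0 ≤ b) (h : p + e + a = q + f + b) :
    ∃ n : Fin 3 → Fin 3 → ℝ, (∀ i j, 0 ≤ n i j) ∧ (∀ i, ∑ j, n i j = ![p, e, a] i) ∧
      (∀ j, ∑ i, n i j = ![q, f, b] j) ∧
      ∑ i, ∑ j, (![![1, 1, 1], ![1, 2, 2], ![1, 2, 3]] : Fin 3 → Fin 3 → ℝ) i j * n i j ≤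
        p + e + a + max (a - q - f) 0 + max (a + e - q) 0 := by
  have hl₁ := le_max_left (a - q - f) 0
  have hr₁ := le_max_right (a - q - f) 0
  have hl₂ := le_max_left (a + e - q) 0
  have hr₂ := le_max_right (a + e - q) 0
  rcases le_or_gt (q + f) a with h1 | h1
  · refine ⟨![![0, 0, p], ![0, 0, e], ![q, f, a - q - f]], ?_, ?_, ?_, ?_⟩
    · simp [Fin.forall_fin_succ]
      grind
    · simp [Fin.forall_fin_succ, Fin.sum_univ_succ]
    · simp [Fin.forall_fin_succ, Fin.sum_univ_succ]
      grind
    · simp [Fin.sum_univ_succ]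
      linarith
  rcases le_or_gt q (a + e) with h2 | h2
  · refine ⟨![![0, p - min p b, min p b],
      ![q - min a q, e - (q - min a q) - (b - min p b), b - min p b],
      ![min a q, a - min a q, 0]], ?_, ?_, ?_, ?_⟩
    · simp [Fin.forall_fin_succ]
      grind
    · simp [Fin.forall_fin_succ, Fin.sum_univ_succ]
    · simp [Fin.forall_fin_succ, Fin.sum_univ_succ]
      grind
    · simp [Fin.sum_univ_succ]
      linarith
  · refine ⟨![![q - a - e, f, b], ![e, 0, 0], ![a, 0, 0]], ?_, ?_, ?_, ?_⟩
    · simp [Fin.forall_fin_succ]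
      grind
    · simp [Fin.forall_fin_succ, Fin.sum_univ_succ]
      grind
    · simp [Fin.forall_fin_succ, Fin.sum_univ_succ]
      grind
    · simp [Fin.sum_univ_succ]
      linarith

/-- The part of `a` beyond `min a b` on the common neighbors of `x` and `y`. -/
noncomputable def commonExcess {V : Type*} (G : SimpleGraph V) (x y : V) (a b : V → ℝ) :
    V → ℝ :=
  fun z => if G.Adj x z ∧ G.Adj y z then a z - min (a z) (b z) else 0

/-- The part of `a` on the neighbors of `x` that are neither `y` nor adjacent to `y`. -/
noncomputable def privatePart {V : Type*} (G : SimpleGraph V) (x y : V) (a : V → ℝ) : V → ℝ :=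
  fun z => if G.Adj x z ∧ ¬ G.Adj y z ∧ z ≠ y then a z else 0

/-- The common part of `a` and `b` on the common neighbors of `x` and `y`. -/
noncomputable def commonMin {V : Type*} (G : SimpleGraph V) (x y : V) (a b : V → ℝ) : V → ℝ :=
  fun z => if G.Adj x z ∧ G.Adj y z then min (a z) (b z) else 0

theorem commonMin_comm {V : Type*} (G : SimpleGraph V) (x y : V) (a b : V → ℝ) :
    commonMin G x y a b = commonMin G y x b a := by
  ext z
  simp [commonMin, and_comm, min_comm]

/-- Decomposition of `a` into its common part, its mass at `y`, its excess on common neighbors and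
its private part. -/
theorem eq_sum_parts {V : Type*} (G : SimpleGraph V) {x : V} (y : V) {a : V → ℝ}
    (ha : ∀ z, ¬ G.Adj x z → a z = 0) (b : V → ℝ) :
    a = commonMin G x y a b + ∑ i, ![Pi.single y (a y), commonExcess G x y a b,
      privatePart G x y a] i := by
  ext z
  simp only [Fin.sum_univ_three, Matrix.cons_val, Pi.add_apply, commonMin, commonExcess,
    privatePart, Pi.single_apply]
  have := ha z
  by_cases h : z = y
  · subst h
    simp
  · by_cases h1 : G.Adj x z <;> by_cases h2 : G.Adj y z <;> simp [h, h1, h2, this]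

theorem parts_nonneg {V : Type*} (G : SimpleGraph V) (x y : V) {a : V → ℝ}
    (ha : ∀ z, 0 ≤ a z) (b : V → ℝ) (i : Fin 3) (u : V) :
    0 ≤ ![Pi.single y (a y), commonExcess G x y a b, privatePart G x y a] i u := by
  fin_cases i
  · by_cases h : u = y <;> simp [h, ha]
  · by_cases h : G.Adj x u ∧ G.Adj y u <;> simp [commonExcess, h]
  · by_cases h : G.Adj x u ∧ ¬ G.Adj y u ∧ u ≠ y
    · simpa [privatePart, h] using ha u
    · simp [privatePart, h]

theorem adj_of_part_ne_zero {V : Type*} (G : SimpleGraph V) {x y : V} (hxy : G.Adj x y)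
    (a b : V → ℝ) (i : Fin 3) (u : V)
    (h : ![Pi.single y (a y), commonExcess G x y a b, privatePart G x y a] i u ≠ 0) :
    G.Adj x u ∧ (i = 0 → u = y) ∧ (i = 1 → G.Adj y u) := by
  fin_cases i
  · have : u = y := by
      by_contra hu
      simp [hu] at h
    simp [this, hxy]
  · have : G.Adj x u ∧ G.Adj y u := by
      by_contra hu
      simp [commonExcess, hu] at h
    simp [this]
  · have : G.Adj x u ∧ ¬ G.Adj y u ∧ u ≠ y := by
      by_contra hu
      simp [privatePart, hu] at h
    simp [this.1]

/-- Transport between probability measures concentrated on the neighborhoods of two adjacent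
vertices. -/
theorem hasPlanOn_of_adj {V : Type*} (G : SimpleGraph V) {x y : V} (hxy : G.Adj x y)
    {S : Finset V} (hxS : ∀ z, G.Adj x z → z ∈ S) (hyS : ∀ z, G.Adj y z → z ∈ S)
    {a b : V → ℝ} (ha : ∀ z, 0 ≤ a z) (hb : ∀ z, 0 ≤ b z)
    (hax : ∀ z, ¬ G.Adj x z → a z = 0) (hby : ∀ z, ¬ G.Adj y z → b z = 0)
    (ha1 : ∑ z ∈ S, a z = 1) (hb1 : ∑ z ∈ S, b z = 1) :
    HasPlanOn S (fun u v => (G.dist u v : ℝ)) a b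
      (1 - ∑ z ∈ S, (if G.Adj x z ∧ G.Adj y z then min (a z) (b z) else 0)
        + max (1 - a y - b x -
          ∑ z ∈ S, if G.Adj x z ∧ G.Adj y z then max (a z) (b z) else 0) 0
        + max (1 - a y - b x -
          ∑ z ∈ S, if G.Adj x z ∧ G.Adj y z then min (a z) (b z) else 0) 0) := by
  have hmin : ∑ z ∈ S, (if G.Adj x z ∧ G.Adj y z then min (a z) (b z) else 0) =
      ∑ z ∈ S, commonMin G x y a b z := rfl
  have hmax : ∑ z ∈ S, (if G.Adj x z ∧ G.Adj y z then max (a z) (b z) else 0) =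
      ∑ z ∈ S, commonMin G x y a b z + ∑ z ∈ S, commonExcess G x y a b z +
        ∑ z ∈ S, commonExcess G y x b a z := by
    rw [← Finset.sum_add_distrib, ← Finset.sum_add_distrib]
    refine Finset.sum_congr rfl fun z _ => ?_
    have := min_add_max (a z) (b z)
    by_cases h : G.Adj x z ∧ G.Adj y z
    · simp only [commonMin, commonExcess, h, and_self, if_true, min_comm (b z)]
      linarith
    · simp [commonMin, commonExcess, h, mt And.symm h]
  have mass {x y : V} (hyS : y ∈ S) {a : V → ℝ}
      (hax : ∀ z, ¬ G.Adj x z → a z = 0) (b : V → ℝ) (ha1 : ∑ z ∈ S, a z = 1) :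
      ∑ z ∈ S, commonMin G x y a b z + (a y + ∑ z ∈ S, commonExcess G x y a b z +
        ∑ z ∈ S, privatePart G x y a z) = 1 := by
    rw [← ha1]
    conv_rhs => rw [eq_sum_parts G y hax b]
    simp [Fin.sum_univ_three, Finset.sum_add_distrib, hyS, Finset.sum_pi_single']
  have hma := mass (hxS y hxy) hax b ha1
  have hmb := mass (hyS x hxy.symm) hby a hb1
  rw [commonMin_comm] at hmb
  have na := fun i => Finset.sum_nonneg fun u (_ : u ∈ S) => parts_nonneg G x y ha b i u
  have nb := fun i => Finset.sum_nonneg fun u (_ : u ∈ S) => parts_nonneg G y x hb a i u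
  obtain ⟨n, hn, hrow, hcol, hcost⟩ := exists_three_block_plan (ha y) (na 1) (na 2)
    (hb x) (nb 1) (nb 2) (by simp only [Matrix.cons_val]; linarith)
  have hblock := HasPlanOn.of_blocks (S := S) (d := fun u v => (G.dist u v : ℝ))
    (n := n) (k := ![![1, 1, 1], ![1, 2, 2], ![1, 2, 3]])
    (parts_nonneg G x y ha b) (parts_nonneg G y x hb a)
    (fun i u hu => hxS u (adj_of_part_ne_zero G hxy a b i u hu).1)
    (fun i u hu => hyS u (adj_of_part_ne_zero G hxy.symm b a i u hu).1)
    hn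
    (by
      intro i
      rw [hrow]
      fin_cases i <;> simp [Finset.sum_pi_single', hxS y hxy])
    (by
      intro j
      rw [hcol]
      fin_cases j <;> simp [Finset.sum_pi_single', hyS x hxy.symm])
    (by
      intro i j u v hu hv
      obtain ⟨hxu, hu0, hu1⟩ := adj_of_part_ne_zero G hxy a b i u hu
      obtain ⟨hyv, hv0, hv1⟩ := adj_of_part_ne_zero G hxy.symm b a j v hv
      have one {s t : V} (h : G.Adj s t) : G.dist s t ≤ 1 := G.dist_le h.toWalk
      have two {s r t : V} (h : G.Adj s r) (h' : G.Adj r t) : G.dist s t ≤ 2 :=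
        G.dist_le (.cons h (.cons h' .nil))
      have hi0 : i = 0 → G.dist u v ≤ 1 := fun hi => one ((hu0 hi).symm ▸ hyv)
      have hj0 : j = 0 → G.dist u v ≤ 1 := fun hj => one ((hv0 hj).symm ▸ hxu.symm)
      have hi1 : i = 1 → G.dist u v ≤ 2 := fun hi => two (hu1 hi).symm hyv
      have hj1 : j = 1 → G.dist u v ≤ 2 := fun hj => two hxu.symm (hv1 hj)
      have three : G.dist u v ≤ 3 := G.dist_le (.cons hxu.symm (.cons hxy (.cons hyv .nil)))
      clear hu hv
      fin_cases i <;> fin_cases j <;> simp at hi0 hj0 hi1 hj1 ⊢ <;> assumption)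
  have hdiag : HasPlanOn S (fun u v => (G.dist u v : ℝ)) (commonMin G x y a b)
      (commonMin G x y a b) 0 := by
    refine HasPlanOn.refl (fun u => ?_) (fun u hu => ?_) (by simp)
    · by_cases h : G.Adj x u ∧ G.Adj y u <;> simp [commonMin, h, ha, hb]
    · refine hxS u ?_
      by_contra h
      simp [commonMin, h] at hu
  have hsum := hdiag.add hblock
  rw [← eq_sum_parts G y hax b, commonMin_comm G x y, ← eq_sum_parts G x hby a] at hsum
  obtain ⟨γ, h0, hS, h1, h2, hc⟩ := hsum
  refine ⟨γ, h0, hS, h1, h2, hc.trans ?_⟩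
  rw [zero_add]
  refine hcost.trans (le_of_eq ?_)
  rw [hmin, hmax]
  simp only [Matrix.cons_val]
  congr 1
  · congr 1
    · linarith
    · congr 1
      linarith
  · congr 1
    linarith

/-- Lower bound on the Ollivier–Ricci curvature of the `α`-lazy random walk at adjacent
vertices of a weighted, connected, locally finite simple graph. -/
theorem graph_lazy_orc_lower_bound {V : Type*} (G : SimpleGraph V) [G.LocallyFinite]
    (hconn : G.Connected)
    (w : V → V → ℝ) (hsymm : ∀ u v, w u v = w v u)
    (hpos : ∀ u v, G.Adj u v → 0 < w u v)
    (D : V → ℝ) (hD : ∀ v, D v = ∑ u ∈ G.neighborFinset v, w v u)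
    (μ : V → V → ℝ) (hμ : ∀ v u, μ v u = if G.Adj v u then w v u / D v else 0)
    (α : ℝ) (hα : α ∈ Set.Ioo (0 : ℝ) 1)
    (x y : V) (hxy : G.Adj x y) :
    1 - W1 (fun u v => (G.dist u v : ℝ))
        (fun u => α * (if u = x then 1 else 0) + (1 - α) * μ x u)
        (fun u => α * (if u = y then 1 else 0) + (1 - α) * μ y u) ≥
      (1 - α) *
        (- max (1 - w x y / D x - w x y / D y -
              ∑ᶠ z, if G.Adj z x ∧ G.Adj z y then max (w z x / D x) (w z y / D y) else 0) 0
         - max (1 - w x y / D x - w x y / D y -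
              ∑ᶠ z, if G.Adj z x ∧ G.Adj z y then min (w z x / D x) (w z y / D y) else 0) 0
         + ∑ᶠ z, if G.Adj z x ∧ G.Adj z y then min (w z x / D x) (w z y / D y) else 0) := by
  obtain ⟨hα0, hα1⟩ := hα
  have hDpos : ∀ {u v}, G.Adj u v → 0 < D u := fun {u v} h => by
    rw [hD]
    exact Finset.sum_pos (fun z hz => hpos u z (by simpa using hz)) ⟨v, by simpa using h⟩
  have hμ0 : ∀ v u, 0 ≤ μ v u := fun v u => by
    rw [hμ]
    split_ifs with h
    exacts [(div_pos (hpos _ _ h) (hDpos h)).le, le_rfl]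
  have hμadj : ∀ v u, ¬ G.Adj v u → μ v u = 0 := fun v u h => by rw [hμ, if_neg h]
  have hμ1 : ∀ {u v}, G.Adj u v → ∀ S : Finset V, (∀ z, G.Adj u z → z ∈ S) →
      ∑ z ∈ S, μ u z = 1 := fun {u v} h S hS => by
    have hsub : G.neighborFinset u ⊆ S := fun z hz => hS z (by simpa using hz)
    rw [← Finset.sum_subset hsub fun z _ hz => hμadj u z (by simpa using hz),
      Finset.sum_congr rfl fun z hz => by rw [hμ, if_pos (by simpa using hz)],
      ← Finset.sum_div, ← hD, div_self (hDpos h).ne']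
  let S := G.neighborFinset x ∪ G.neighborFinset y
  have hxS : ∀ z, G.Adj x z → z ∈ S := fun z hz => by simp [S, hz]
  have hyS : ∀ z, G.Adj y z → z ∈ S := fun z hz => by simp [S, hz]
  have hfin : ∀ m : ℝ → ℝ → ℝ,
      (∑ᶠ z, if G.Adj z x ∧ G.Adj z y then m (w z x / D x) (w z y / D y) else 0) =
        ∑ z ∈ S, if G.Adj x z ∧ G.Adj y z then m (μ x z) (μ y z) else 0 := fun m => by
    rw [finsum_eq_sum_of_support_subset (s := S)]
    · refine Finset.sum_congr rfl fun z _ => ?_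
      rw [G.adj_comm z x, G.adj_comm z y]
      split_ifs with h
      · rw [hμ x, hμ y, if_pos h.1, if_pos h.2, hsymm z x, hsymm z y]
      · rfl
    · intro z hz
      by_contra hzS
      exact hz (if_neg fun h => hzS (hxS z h.1.symm))
  have hμx : w x y / D x = μ x y := by rw [hμ, if_pos hxy]
  have hμy : w x y / D y = μ y x := by rw [hμ, if_pos hxy.symm, hsymm]
  rw [hfin min, hfin max, hμx, hμy]
  have hplan := hasPlanOn_of_adj G hxy hxS hyS (hμ0 x) (hμ0 y) (hμadj x) (hμadj y)
    (hμ1 hxy S hxS) (hμ1 hxy.symm S hyS)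
  have hx := hyS x hxy.symm
  have hy := hxS y hxy
  have hdirac : HasPlanOn S (fun u v => (G.dist u v : ℝ)) (fun u => if u = x then 1 else 0)
      (fun u => if u = y then 1 else 0) 1 := by
    have := HasPlanOn.prod (S := S) (d := fun u v => (G.dist u v : ℝ))
      (σ := fun u => if u = x then 1 else 0) (τ := fun u => if u = y then 1 else 0)
      (s := 1) (t := 1) (n := 1) (k := 1) (fun u => by positivity) (fun u => by positivity)
      (fun u hu => by simp at hu; exact hu ▸ hx) (fun u hu => by simp at hu; exact hu ▸ hy)
      (by simp [hx]) (by simp [hy]) zero_le_one (by simp) (by simp)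
      (fun u v hu hv => by
        simp at hu hv
        subst hu hv
        exact_mod_cast G.dist_le hxy.toWalk)
    simpa using this
  have hW := ((hdirac.smul hα0.le).add (hplan.smul (sub_nonneg.2 hα1.le))).W1_le
    (fun u v => Nat.cast_nonneg _)
  simp only [ge_iff_le]
  refine le_trans (le_of_eq ?_) (sub_le_sub_left hW 1)
  ring
end
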